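/- arXiv:1401.8260 — 5 statements merged into one kernel-verified Lean document; each statement's English description precedes it below -/
import Mathlib

section
/- The Smith group (cokernel of the adjacency matrix acting on the free abelian group on the vertices) of the Paley graph P(q) is isomorphic to Z/2μZ ⊕ (Z/μZ)^{2μ}, where μ=(q-1)/4. -/
open TensorProduct in
/-- If `Rⁿ ≅ M × M × R`, the base change of `M` to a field has rank `(n - 1) / 2`. -/
lemma finrank_tensor_of_equiv_prod {R K M ι : Type*} [CommRing R] [Field K] [Algebra R K]
    [AddCommGroup M] [Module R M] [Module.Finite R M] [Fintype ι]
    (e : (ι → R) ≃ₗ[R] M × M × R) :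
    2 * Module.finrank K (K ⊗[R] M) + 1 = Fintype.card ι := by
  classical
  have e' : (ι → K) ≃ₗ[K] (K ⊗[R] M) × (K ⊗[R] M) × K :=
    (TensorProduct.piScalarRight R K K ι).symm ≪≫ₗ e.baseChange R K _ _ ≪≫ₗ
      TensorProduct.prodRight R K K M (M × R) ≪≫ₗ
      (LinearEquiv.refl K _).prodCongr (TensorProduct.prodRight R K K M R ≪≫ₗ
        (LinearEquiv.refl K _).prodCongr (TensorProduct.AlgebraTensorModule.rid R K K))
  have h := e'.finrank_eq
  rw [Module.finrank_prod, Module.finrank_prod, Module.finrank_self, Module.finrank_pi] at h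
  omega

/-- A direct summand `M` of `Rⁿ`, where `n = 2 * k + 1`, with complement isomorphic to `M × R` is
free of rank `k` when `R` is semilocal. -/
lemma nonempty_basis_of_equiv_prod {R M ι : Type*} [CommRing R] [Finite (MaximalSpectrum R)]
    [AddCommGroup M] [Module R M] [Fintype ι] {k : ℕ} (hk : Fintype.card ι = 2 * k + 1)
    (e : (ι → R) ≃ₗ[R] M × M × R) : Nonempty (Module.Basis (Fin k) R M) := by
  have : Module.Finite R M :=
    Module.Finite.of_surjective (LinearMap.fst R M (M × R) ∘ₗ e.toLinearMap)
      (Prod.fst_surjective.comp e.surjective)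
  have : Module.Projective R M :=
    Module.Projective.of_split (e.symm.toLinearMap ∘ₗ LinearMap.inl R M (M × R))
      (LinearMap.fst R M (M × R) ∘ₗ e.toLinearMap) (by ext; simp)
  refine Module.nonempty_basis_of_flat_of_finrank_eq R M k fun P => ?_
  let := Ideal.Quotient.field P.1
  have := finrank_tensor_of_equiv_prod (K := R ⧸ P.1) e
  omega

section Idempotent

variable {V R : Type*} [Fintype V] [CommRing R]

/-- The mutually orthogonal idempotents `E`, `-A` and `J` (the all-ones matrix), with sum `1`,
decompose `R^V`. -/
lemma nonempty_equiv_range_prod {A E : Matrix V V R}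
    (hcard : (Fintype.card V : R) = 1)
    (hE : ∀ x, E.mulVec x = fun v => x v + A.mulVec x v - ∑ u, x u)
    (hAA : ∀ x, A.mulVec (A.mulVec x) = -A.mulVec x)
    (hAJ : ∀ c : R, A.mulVec (fun _ => c) = 0)
    (hJA : ∀ x, ∑ v, A.mulVec x v = 0) :
    Nonempty ((V → R) ≃ₗ[R] LinearMap.range E.mulVecLin × LinearMap.range A.mulVecLin × R) := by
  have hJE : ∀ x, ∑ v, E.mulVec x v = 0 := fun x => by
    simp [hE, Finset.sum_sub_distrib, Finset.sum_add_distrib, hJA, hcard]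
  have hAE : ∀ x, A.mulVec (E.mulVec x) = 0 := fun x => by
    have : E.mulVec x = x + A.mulVec x - fun _ => ∑ u, x u := hE x
    rw [this, Matrix.mulVec_sub, Matrix.mulVec_add, hAA, hAJ]; simp
  have hEA : ∀ x, E.mulVec (A.mulVec x) = 0 := fun x => by
    funext v
    simp [hE, hJA, hAA]
  have hEJ : ∀ c : R, E.mulVec (fun _ => c) = 0 := fun c => by
    funext v
    simp [hE, hAJ, hcard]
  have hEE : ∀ x, E.mulVec (E.mulVec x) = E.mulVec x := fun x => by
    rw [hE (E.mulVec x), hAE]; simp [hJE]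
  let s : (V → R) →ₗ[R] R := ∑ v, LinearMap.proj v
  have hs : ∀ x, s x = ∑ v, x v := fun x => by simp [s]
  refine ⟨LinearEquiv.ofBijective
    (E.mulVecLin.rangeRestrict.prod (A.mulVecLin.rangeRestrict.prod s)) ⟨?_, ?_⟩⟩
  · rw [← LinearMap.ker_eq_bot, LinearMap.ker_eq_bot']
    intro x hx
    obtain ⟨h1, h2, h3⟩ : E.mulVec x = 0 ∧ A.mulVec x = 0 ∧ s x = 0 := by
      simpa [Prod.ext_iff, Subtype.ext_iff] using hx
    have := hE x
    rw [h1, h2, ← hs, h3] at this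
    simpa using this.symm
  · rintro ⟨⟨_, w, rfl⟩, ⟨_, u, rfl⟩, c⟩
    refine ⟨E.mulVec w - A.mulVec u + fun _ => c, ?_⟩
    simp [Prod.ext_iff, Subtype.ext_iff, hEE, hEA, hEJ,
      hAE, hAA, hAJ, hs, Finset.sum_add_distrib, hJE, hJA, hcard]

/-- A permutation of the index set carrying `A` to `-E` identifies the ranges of the two matrices. -/
lemma nonempty_equiv_range_of_submatrix {A E : Matrix V V R} (σ : Equiv.Perm V)
    (h : A.submatrix σ σ = -E) :
    Nonempty (LinearMap.range A.mulVecLin ≃ₗ[R] LinearMap.range E.mulVecLin) := by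
  let e : (V → R) ≃ₗ[R] (V → R) := LinearEquiv.funCongrLeft R R σ
  have he : ∀ x, e (A.mulVec x) = E.mulVec (-e x) := fun x => by
    rw [Matrix.mulVec_neg, ← Matrix.neg_mulVec, ← h]
    have hx : e x ∘ σ.symm = x := funext fun v => congrArg x (σ.apply_symm_apply v)
    rw [Matrix.submatrix_mulVec_equiv, hx]
    rfl
  refine ⟨e.submoduleMap _ ≪≫ₗ LinearEquiv.ofEq _ _ ?_⟩
  ext y
  constructor
  · rintro ⟨_, ⟨x, rfl⟩, rfl⟩
    exact ⟨-e x, (he x).symm⟩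
  · rintro ⟨x, rfl⟩
    exact ⟨A.mulVec (-e.symm x), ⟨_, rfl⟩, by simpa using he (-e.symm x)⟩

end Idempotent

/-- The Smith group of a strongly regular graph with Paley parameters which is isomorphic to its
complement. -/
lemma nonempty_quotient_equiv_of_selfComplementary {V : Type*} [Fintype V] [DecidableEq V]
    {m : ℕ} [NeZero m] (hcard : Fintype.card V = 4 * m + 1) {A : Matrix V V ℤ}
    (hAA : A * A + A = (m : ℤ) • (1 + Matrix.of fun _ _ => 1))
    (hAJ : ∀ v, ∑ u, A v u = 2 * m) (hJA : ∀ u, ∑ v, A v u = 2 * m)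
    (σ : Equiv.Perm V) (hσ : A.submatrix σ σ = (Matrix.of fun _ _ => 1) - 1 - A) :
    Nonempty (((V → ℤ) ⧸ LinearMap.range (Matrix.toLin' A)) ≃+
      (ZMod (2 * m) × (Fin (2 * m) → ZMod m))) := by
  have vAA : ∀ x, A.mulVec (A.mulVec x) = fun v => m * x v + m * ∑ u, x u - A.mulVec x v := by
    intro x
    have := congrArg (fun B => B.mulVec x) hAA
    funext v
    have := congrFun this v
    simp [Matrix.add_mulVec, ← Matrix.mulVec_mulVec] at this
    simp [Matrix.mulVec, dotProduct, ← Finset.mul_sum] at this ⊢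
    linarith
  have vAJ : ∀ c : ℤ, A.mulVec (fun _ => c) = fun _ => 2 * m * c := by
    intro c; funext v; simp [Matrix.mulVec, dotProduct, ← Finset.sum_mul, hAJ]
  have vJA : ∀ x, ∑ v, A.mulVec x v = 2 * m * ∑ u, x u := by
    intro x
    simp only [Matrix.mulVec, dotProduct]
    rw [Finset.sum_comm]
    simp [← Finset.sum_mul, hJA, Finset.mul_sum]
  let E : Matrix V V ℤ := 1 + A - Matrix.of fun _ _ => 1
  have vE : ∀ x, E.mulVec x = fun v => x v + A.mulVec x v - ∑ u, x u := by
    intro x; funext v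
    simp [E, Matrix.sub_mulVec, Matrix.add_mulVec]
    simp [Matrix.mulVec, dotProduct]
  have vAE : ∀ x, A.mulVec (E.mulVec x) = fun v => m * (x v - ∑ u, x u) := by
    intro x
    have : E.mulVec x = x + A.mulVec x - fun _ => ∑ u, x u := vE x
    rw [this, Matrix.mulVec_sub, Matrix.mulVec_add, vAA, vAJ]
    funext v
    simp only [Pi.add_apply, Pi.sub_apply]
    ring
  have vJE : ∀ x, ∑ v, E.mulVec x v = -(2 * m * ∑ u, x u) := by
    intro x
    simp only [vE, Finset.sum_sub_distrib, Finset.sum_add_distrib, vJA, Finset.sum_const,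
      Finset.card_univ, hcard, nsmul_eq_mul]
    push_cast
    ring
  let φ := Int.castRingHom (ZMod m)
  have hφ : ∀ (B : Matrix V V ℤ) (x : V → ℤ), (B.map φ).mulVec (φ ∘ x) = φ ∘ B.mulVec x :=
    fun B x => by funext v; exact (RingHom.map_mulVec φ B x v).symm
  have hlift : ∀ y : V → ZMod m, ∃ x : V → ℤ, φ ∘ x = y := fun y =>
    (ZMod.intCast_surjective.comp_left) y
  have hm : φ (m : ℤ) = 0 := by simp [φ]
  have hcardR : (Fintype.card V : ZMod m) = 1 := by simp [hcard]
  have b : Nonempty (Module.Basis (Fin (2 * m)) (ZMod m)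
      (LinearMap.range (E.map φ).mulVecLin)) := by
    obtain ⟨e⟩ := nonempty_equiv_range_prod (A := A.map φ) (E := E.map φ) hcardR
      (fun y => by
        obtain ⟨x, rfl⟩ := hlift y
        rw [hφ, hφ, vE]; funext v; simp)
      (fun y => by
        obtain ⟨x, rfl⟩ := hlift y
        rw [hφ, hφ, vAA]; funext v; simp [φ])
      (fun c => by
        obtain ⟨c, rfl⟩ := ZMod.intCast_surjective c
        have := hφ A (fun _ => c)
        rw [vAJ] at this
        refine Eq.trans this ?_
        funext v; simp [φ])
      (fun y => by
        obtain ⟨x, rfl⟩ := hlift y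
        rw [hφ]
        have := congrArg φ (vJA x)
        simpa [φ] using this)
    obtain ⟨e'⟩ := nonempty_equiv_range_of_submatrix (A := A.map φ) (E := E.map φ) σ (by
      rw [Matrix.submatrix_map, hσ]
      ext i j
      simp [E]; ring)
    have : Finite (MaximalSpectrum (ZMod m)) := inferInstance
    exact nonempty_basis_of_equiv_prod (by omega)
      (e ≪≫ₗ (LinearEquiv.refl _ _).prodCongr (e'.prodCongr (LinearEquiv.refl _ _)))
  obtain ⟨b⟩ := b
  let f₁ : (V → ℤ) →+ ZMod (2 * m) :=
    (Int.castAddHom _).comp (∑ v, Pi.evalAddMonoidHom (fun _ : V => ℤ) v)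
  let f₂ : (V → ℤ) →+ LinearMap.range (E.map φ).mulVecLin :=
    (E.map φ).mulVecLin.rangeRestrict.toAddMonoidHom.comp (φ.toAddMonoidHom.compLeft V)
  have hf₁ : ∀ x, f₁ x = ((∑ v, x v : ℤ) : ZMod (2 * m)) := fun x => by simp [f₁]
  have hf₂ : ∀ x, (f₂ x : V → ZMod m) = φ ∘ E.mulVec x := fun x => hφ E x
  let f := (f₁.prod f₂).toIntLinearMap
  have hker : LinearMap.range (Matrix.toLin' A) = LinearMap.ker f := by
    ext x
    have hx : x ∈ LinearMap.ker f ↔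
        ((2 * m : ℕ) : ℤ) ∣ ∑ v, x v ∧ ∀ v, (m : ℤ) ∣ E.mulVec x v := by
      rw [LinearMap.mem_ker]
      change (f₁ x, f₂ x) = 0 ↔ _
      rw [Prod.mk_eq_zero, hf₁, ZMod.intCast_zmod_eq_zero_iff_dvd, ← Subtype.coe_inj, hf₂,
        funext_iff]
      simp only [Function.comp, φ, Int.coe_castRingHom, ZeroMemClass.coe_zero, Pi.zero_apply,
        ZMod.intCast_zmod_eq_zero_iff_dvd]
    rw [hx]
    constructor
    · rintro ⟨y, rfl⟩
      rw [Matrix.toLin'_apply, vJA]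
      refine ⟨⟨∑ u, y u, by push_cast; ring⟩, fun v => ⟨y v - ∑ u, y u, ?_⟩⟩
      rw [vE, vAA, vJA]; ring
    · rintro ⟨⟨c, hc⟩, h⟩
      choose y hy using h
      have hm0 : (m : ℤ) ≠ 0 := by exact_mod_cast NeZero.ne m
      push_cast at hc
      have hx : x = (m : ℤ) • y + (fun _ => 2 * m * c) - A.mulVec x := by
        funext v
        have := hy v
        rw [vE, hc] at this
        simp; linarith
      have hsum : ∑ u, y u = 2 * (c * (1 + 2 * m) - c * (4 * m + 1)) := by
        have := congrArg (fun z : V → ℤ => ∑ v, z v) hx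
        simp only [Pi.add_apply, Pi.sub_apply, Finset.sum_add_distrib, Finset.sum_sub_distrib,
          vJA, hc, Pi.smul_apply, smul_eq_mul, ← Finset.mul_sum, Finset.sum_const,
          Finset.card_univ, hcard, nsmul_eq_mul] at this
        push_cast at this
        apply mul_left_cancel₀ hm0
        linarith
      have hx2 : x = A.mulVec (A.mulVec y + y - (fun _ => c * (1 + 2 * m) - c * (4 * m + 1))
          + (fun _ => c) - x) := by
        rw [Matrix.mulVec_sub, Matrix.mulVec_add, Matrix.mulVec_sub, Matrix.mulVec_add, vAA, vAJ,
          vAJ]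
        refine hx.trans ?_
        funext v
        simp only [Pi.add_apply, Pi.sub_apply, Pi.smul_apply, smul_eq_mul, hsum]
        ring
      exact ⟨_, hx2.symm⟩
  have hsurj : Function.Surjective f := by
    rintro ⟨a, ⟨_, w, rfl⟩⟩
    obtain ⟨a, rfl⟩ := ZMod.intCast_surjective a
    obtain ⟨w, rfl⟩ := hlift w
    refine ⟨E.mulVec w + fun _ => a - ∑ v, E.mulVec w v, ?_⟩
    refine Prod.ext ?_ (Subtype.ext ?_)
    · change f₁ _ = _
      rw [hf₁]
      simp only [Pi.add_apply, Finset.sum_add_distrib, Finset.sum_const, Finset.card_univ, hcard,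
        nsmul_eq_mul]
      have : ((2 * m : ℕ) : ZMod (2 * m)) = 0 := ZMod.natCast_self _
      push_cast at this ⊢
      linear_combination 2 * ((a : ZMod (2 * m)) - ∑ v, (E.mulVec w v : ZMod (2 * m))) * this
    · change (f₂ _ : V → ZMod m) = (E.map φ).mulVec (φ ∘ w)
      rw [hf₂, hφ]
      funext v
      have hz := congrFun (vE (E.mulVec w + fun _ => a - ∑ v, E.mulVec w v)) v
      simp only [Matrix.mulVec_add A, Pi.add_apply, Finset.sum_add_distrib, vAE, vAJ, vJE,
        Finset.sum_const, Finset.card_univ, hcard, nsmul_eq_mul] at hz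
      simp only [vJE, Function.comp, hz]
      simp [φ]
  exact ⟨((Submodule.quotEquivOfEq _ _ hker).trans
    (f.quotKerEquivOfSurjective hsurj)).toAddEquiv.trans
      ((AddEquiv.refl _).prodCongr b.equivFun.toAddEquiv)⟩

section Paley

variable {F : Type*} [Field F] [Fintype F] [DecidableEq F]

lemma sum_quadraticChar_sub_mul_sub (hF : Fintype.card F % 4 = 1) (x y : F) :
    ∑ z, quadraticChar F (x - z) * quadraticChar F (z - y) =
      if x = y then (Fintype.card F : ℤ) - 1 else -1 := by
  have h2 : ringChar F ≠ 2 := by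
    rw [Ne, FiniteField.even_card_iff_char_two.not]; omega
  have hneg : quadraticChar F (-1) = 1 := by
    rw [quadraticChar_one_iff_isSquare (by simp), FiniteField.isSquare_neg_one_iff]; omega
  split_ifs with hxy
  · subst hxy
    have : ∀ z, quadraticChar F (x - z) * quadraticChar F (z - x) = 1 - if z = x then 1 else 0 := by
      intro z
      split_ifs with h
      · simp [h]
      · rw [← neg_sub x z, ← neg_one_mul (x - z), map_mul, hneg, one_mul, ← sq,
          quadraticChar_sq_one (sub_ne_zero.2 (Ne.symm h)), sub_zero]
    simp [this, -quadraticChar_apply]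
  · have hd : x - y ≠ 0 := sub_ne_zero.2 hxy
    have hj := jacobiSum_nontrivial_inv (quadraticChar_ne_one h2)
    rw [(quadraticChar_isQuadratic F).inv, hneg, jacobiSum] at hj
    rw [← hj]
    let e : F ≃ F := (Equiv.mulLeft₀ (x - y) hd).trans (Equiv.subLeft x)
    rw [← e.sum_comp]
    refine Finset.sum_congr rfl fun t _ => ?_
    have h1 : x - e t = (x - y) * t := by simp [e]
    have h2 : e t - y = (x - y) * (1 - t) := by simp [e]; ring
    rw [h1, h2, map_mul, map_mul]
    linear_combination quadraticChar F t * quadraticChar F (1 - t) * quadraticChar_sq_one hd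

end Paley


/-- The Smith group (cokernel of the adjacency matrix acting on the free abelian
group on the vertices) of the Paley graph `P(q)` is isomorphic to
`ℤ/2μℤ ⊕ (ℤ/μℤ)^{2μ}`, where `μ = (q-1)/4`. -/
theorem paley_smith_group
    (q : ℕ) (hq : IsPrimePow q) (hq4 : q % 4 = 1)
    (F : Type*) [Field F] [Fintype F] [DecidableEq F]
    [DecidablePred (IsSquare : F → Prop)]
    (hcard : Fintype.card F = q)
    (A : Matrix F F ℤ)
    (hA : ∀ x y : F, A x y = if x ≠ y ∧ IsSquare (x - y) then 1 else 0) :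
    Nonempty (((F → ℤ) ⧸ LinearMap.range (Matrix.toLin' A)) ≃+
      (ZMod (2 * ((q - 1) / 4)) × (Fin (2 * ((q - 1) / 4)) → ZMod ((q - 1) / 4)))) := by
  have h2 : ringChar F ≠ 2 := by
    rw [Ne, FiniteField.even_card_iff_char_two.not]; omega
  have hq1 : 1 < q := hq.one_lt
  obtain ⟨m, hm⟩ : ∃ m, q = 4 * m + 1 := ⟨q / 4, by omega⟩
  have hm' : (q - 1) / 4 = m := by omega
  have : NeZero m := ⟨by omega⟩
  rw [hm']
  have hχ : ∀ x y : F, 2 * A x y = quadraticChar F (x - y) + 1 - if x = y then 1 else 0 := by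
    intro x y
    rw [hA]
    by_cases hxy : x = y
    · simp [hxy]
    · by_cases hs : IsSquare (x - y)
      · simp [hxy, hs, (quadraticChar_one_iff_isSquare (sub_ne_zero.2 hxy)).2 hs]
      · simp [hxy, hs, quadraticChar_neg_one_iff_not_isSquare.2 hs]
  have hsum : ∀ x : F, ∑ y, quadraticChar F (x - y) = 0 := fun x =>
    ((Equiv.subLeft x).sum_comp (quadraticChar F)).trans (quadraticChar_sum_zero h2)
  have hsum' : ∀ y : F, ∑ x, quadraticChar F (x - y) = 0 := fun y =>
    ((Equiv.subRight y).sum_comp (quadraticChar F)).trans (quadraticChar_sum_zero h2)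
  have hrow : ∀ v, ∑ u, A v u = 2 * m := fun v => by
    have : 2 * ∑ u, A v u = 4 * m := by
      rw [Finset.mul_sum]
      simp [hχ, Finset.sum_add_distrib, hsum, hcard, hm, -quadraticChar_apply]
    linarith
  have hcol : ∀ u, ∑ v, A v u = 2 * m := fun u => by
    have : 2 * ∑ v, A v u = 4 * m := by
      rw [Finset.mul_sum]
      simp [hχ, Finset.sum_add_distrib, hsum', hcard, hm, -quadraticChar_apply]
    linarith
  obtain ⟨n, hn⟩ := quadraticChar_exists_neg_one h2
  have hn0 : n ≠ 0 := by rintro rfl; simp at hn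
  refine nonempty_quotient_equiv_of_selfComplementary (by omega) ?_ hrow hcol
    (Equiv.mulLeft₀ n hn0) ?_
  · ext x y
    have key : 4 * (A * A) x y = ∑ z, (2 * A x z) * (2 * A z y) := by
      rw [Matrix.mul_apply, Finset.mul_sum]
      exact Finset.sum_congr rfl fun z _ => by ring
    have expand : ∀ z, (2 * A x z) * (2 * A z y) =
        quadraticChar F (x - z) * quadraticChar F (z - y) + quadraticChar F (x - z)
        + quadraticChar F (z - y) + 1 - (if x = z then 2 * A z y else 0)
        - (if z = y then 2 * A x z else 0) - (if x = z then if z = y then 1 else 0 else 0) := by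
      intro z
      rw [hχ, hχ]
      split_ifs <;> ring
    simp only [expand, Finset.sum_sub_distrib, Finset.sum_add_distrib,
      sum_quadraticChar_sub_mul_sub (hcard ▸ hq4), hsum, hsum', Finset.sum_ite_eq,
      Finset.sum_ite_eq', Finset.mem_univ, if_true, Finset.sum_const, Finset.card_univ, hcard,
      hm] at key
    simp only [Matrix.add_apply, Matrix.smul_apply, Matrix.of_apply, Matrix.one_apply]
    split_ifs at key ⊢ <;> simp at key ⊢ <;> linarith
  · ext x y
    have h := hχ (n * x) (n * y)
    rw [← mul_sub, map_mul, hn] at h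
    have h' := hχ x y
    simp only [Matrix.submatrix_apply, Equiv.mulLeft₀_apply, Matrix.sub_apply, Matrix.of_apply,
      Matrix.one_apply]
    simp only [mul_right_inj' hn0] at h
    split_ifs at h h' ⊢ <;> linarith
end

section
/- The number of spanning trees of the Paley graph P(q) equals q^{(q-3)/2}·μ^{(q-1)/2}, where μ=(q-1)/4. -/
section

open Matrix Finset

namespace SimpleGraph

variable {V : Type*}

/-- `f` sends every vertex other than `r` to a neighbour in `G`, fixes `r`, and all its orbits
end in `r`. -/
structure IsParentMap (G : SimpleGraph V) (r : V) (f : V → V) : Prop where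
  map_root : f r = r
  adj : ∀ v, v ≠ r → G.Adj v (f v)
  reaches : ∀ v, ∃ k, f^[k] v = r

/-- The graph joining every vertex to its image under `f`. -/
def ofParentMap (f : V → V) : SimpleGraph V := fromRel fun v w => w = f v

lemma induction_of_reaches {r : V} {f : V → V} (hf : ∀ v, ∃ k, f^[k] v = r) {P : V → Prop}
    (root : P r) (step : ∀ v, v ≠ r → P (f v) → P v) (v : V) : P v := by
  obtain ⟨k, hk⟩ := hf v
  induction k generalizing v with
  | zero =>
    obtain rfl : v = r := hk
    exact root
  | succ k ih =>
    by_cases hv : v = r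
    · exact hv ▸ root
    · exact step v hv (ih _ hk)

lemma exists_depth_of_reaches {r : V} {f : V → V} (hf : ∀ v, ∃ k, f^[k] v = r) :
    ∃ d : V → ℕ, ∀ v, v ≠ r → d (f v) < d v := by
  classical
  refine ⟨fun v => Nat.find (hf v), fun v hv => ?_⟩
  have h := Nat.find_spec (hf v)
  obtain ⟨k, hk⟩ : ∃ k, Nat.find (hf v) = k + 1 :=
    Nat.exists_eq_succ_of_ne_zero fun h0 => hv (by simpa [h0] using h)
  rw [hk] at h
  exact (Nat.find_min' (hf (f v)) h).trans_lt (by lia)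

namespace IsParentMap

variable {G : SimpleGraph V} {r : V} {f g : V → V}

lemma ne (hf : G.IsParentMap r f) {v : V} (hv : v ≠ r) : v ≠ f v := (hf.adj v hv).ne

lemma apply_apply_ne (hf : G.IsParentMap r f) {v : V} (hv : v ≠ r) : f (f v) ≠ v := by
  intro h
  obtain ⟨d, hd⟩ := exists_depth_of_reaches hf.reaches
  have h1 := hd v hv
  by_cases hr : f v = r
  · rw [hr, hf.map_root] at h
    exact hv h.symm
  · have h2 := hd _ hr
    rw [h] at h2
    lia

lemma ofParentMap_adj (hf : G.IsParentMap r f) {v : V} (hv : v ≠ r) :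
    (ofParentMap f).Adj v (f v) := by
  simp [ofParentMap, hf.ne hv]

lemma ofParentMap_le (hf : G.IsParentMap r f) : ofParentMap f ≤ G := by
  have key : ∀ v w, v ≠ w → w = f v → G.Adj v w := by
    rintro v _ hne rfl
    refine hf.adj v ?_
    rintro rfl
    exact hne hf.map_root.symm
  intro v w h
  obtain ⟨hne, h | h⟩ := (fromRel_adj _ _ _).1 h
  · exact key v w hne h
  · exact (key w v hne.symm h).symm

lemma connected_ofParentMap (hf : G.IsParentMap r f) : (ofParentMap f).Connected := by
  have h : ∀ v, (ofParentMap f).Reachable v r :=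
    induction_of_reaches hf.reaches .rfl fun v hv h => (hf.ofParentMap_adj hv).reachable.trans h
  have : Nonempty V := ⟨r⟩
  exact ⟨fun v w => (h v).trans (h w).symm⟩

lemma isTree_ofParentMap [Finite V] (hf : G.IsParentMap r f) : (ofParentMap f).IsTree := by
  have hc := hf.connected_ofParentMap
  refine isTree_iff_connected_and_card.2 ⟨hc, le_antisymm ?_ hc.card_vert_le_card_edgeSet_add_one⟩
  have hs : (ofParentMap f).edgeSet ⊆ (fun v => s(v, f v)) '' {r}ᶜ := by
    intro e
    induction e with | _ v w
    rw [mem_edgeSet]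
    intro h
    obtain ⟨hne, h | h⟩ := (fromRel_adj _ _ _).1 h
    · refine ⟨v, ?_, by simp [h]⟩
      rintro rfl
      exact hne (h.trans hf.map_root).symm
    · refine ⟨w, ?_, by simp [h]⟩
      rintro rfl
      exact hne (h.trans hf.map_root)
  have h1 := (Set.ncard_le_ncard hs).trans (Set.ncard_image_le (Set.toFinite _))
  have h2 := Set.ncard_add_ncard_compl ({r} : Set V)
  rw [Set.ncard_singleton] at h2
  rw [Nat.card_coe_set_eq, ← h2]
  lia

lemma eq_of_ofParentMap_eq (hf : G.IsParentMap r f) (hg : G.IsParentMap r g)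
    (h : ofParentMap f = ofParentMap g) : f = g := by
  funext v
  refine induction_of_reaches (P := fun v => f v = g v) hg.reaches
    (hf.map_root.trans hg.map_root.symm) (fun v hv ih => ?_) v
  have hadj := hg.ofParentMap_adj hv
  rw [← h] at hadj
  obtain ⟨-, h' | h'⟩ := (fromRel_adj _ _ _).1 hadj
  · exact h'.symm
  · exact absurd (ih.symm.trans h'.symm) (hg.apply_apply_ne hv)

end IsParentMap

lemma Connected.exists_isParentMap {T : SimpleGraph V} (hT : T.Connected) (r : V) :
    ∃ f, T.IsParentMap r f := by
  have h : ∀ v, ∃ w, (v = r → w = r) ∧ (v ≠ r → T.Adj v w ∧ T.dist w r < T.dist v r) := by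
    intro v
    by_cases hv : v = r
    · exact ⟨r, fun _ => rfl, fun h => absurd hv h⟩
    obtain ⟨p, hp⟩ := hT.exists_walk_length_eq_dist v r
    cases p with
    | nil => exact absurd rfl hv
    | cons hadj p =>
      refine ⟨_, fun h => absurd h hv, fun _ => ⟨hadj, ?_⟩⟩
      rw [← hp, Walk.length_cons]
      exact Nat.lt_succ_of_le (dist_le p)
  choose f hr hf using h
  refine ⟨f, hr r rfl, fun v hv => (hf v hv).1, fun v => ?_⟩
  induction hn : T.dist v r using Nat.strong_induction_on generalizing v with
  | _ n ih =>
    by_cases hv : v = r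
    · exact ⟨0, hv⟩
    · obtain ⟨k, hk⟩ := ih _ (hn ▸ (hf v hv).2) (f v) rfl
      exact ⟨k + 1, hk⟩

lemma IsParentMap.mono {G H : SimpleGraph V} {r : V} {f : V → V} (hf : G.IsParentMap r f)
    (h : G ≤ H) : H.IsParentMap r f :=
  ⟨hf.map_root, fun v hv => h (hf.adj v hv), hf.reaches⟩

lemma card_isTree_eq_card_isParentMap [Finite V] (G : SimpleGraph V) (r : V) :
    Nat.card {T : SimpleGraph V // T ≤ G ∧ T.IsTree} = Nat.card {f // G.IsParentMap r f} := by
  refine (Nat.card_eq_of_bijective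
    (fun f : {f // G.IsParentMap r f} =>
      (⟨ofParentMap f.1, f.2.ofParentMap_le, f.2.isTree_ofParentMap⟩ :
        {T : SimpleGraph V // T ≤ G ∧ T.IsTree})) ⟨?_, ?_⟩).symm
  · intro f g h
    exact Subtype.ext (f.2.eq_of_ofParentMap_eq g.2 (congrArg Subtype.val h))
  · rintro ⟨T, hle, hT⟩
    obtain ⟨f, hf⟩ := hT.connected.exists_isParentMap r
    exact ⟨⟨f, hf.mono hle⟩, Subtype.ext
      ((isTree_iff_minimal_connected.1 hT).eq_of_le hf.connected_ofParentMap hf.ofParentMap_le)⟩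

lemma card_isSpanning_isTree (G : SimpleGraph V) :
    Nat.card {H : G.Subgraph // H.IsSpanning ∧ H.coe.IsTree} =
      Nat.card {T : SimpleGraph V // T ≤ G ∧ T.IsTree} := by
  refine Nat.card_congr
    { toFun := fun H => ⟨H.1.spanningCoe, H.1.spanningCoe_le,
        (H.1.spanningCoeEquivCoeOfSpanning H.2.1).isTree_iff.2 H.2.2⟩
      invFun := fun T => ⟨toSubgraph T.1 T.2.1, toSubgraph.isSpanning _ _,
        ((toSubgraph T.1 T.2.1).spanningCoeEquivCoeOfSpanning
          (toSubgraph.isSpanning _ _)).isTree_iff.1 T.2.2⟩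
      left_inv := fun H => Subtype.ext (Subgraph.ext ?_ rfl)
      right_inv := fun T => rfl }
  exact (Subgraph.isSpanning_iff.1 H.2.1).symm

variable {R : Type*} [CommRing R] [Fintype V] [DecidableEq V]

lemma det_parentMatrix_eq_one {r : V} {f : V → V} (hf : ∀ v, ∃ k, f^[k] v = r) :
    det (of fun v => if v = r then Pi.single r 1 else Pi.single v 1 - Pi.single (f v) 1 :
      Matrix V V R) = 1 := by
  obtain ⟨d, hd⟩ := exists_depth_of_reaches hf
  have key : ∀ v w, d v ≤ d w →
      (of fun v => if v = r then Pi.single r 1 else Pi.single v 1 - Pi.single (f v) 1 :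
        Matrix V V R) v w = (1 : Matrix V V R) v w := by
    intro v w h
    by_cases hv : v = r
    · subst hv
      simp [Pi.single_apply, Matrix.one_apply, eq_comm]
    · have : w ≠ f v := by
        rintro rfl
        exact absurd (hd v hv) h.not_gt
      simp [hv, Pi.single_apply, Matrix.one_apply, this, eq_comm (a := v)]
  have htri : (of fun v => if v = r then Pi.single r 1 else Pi.single v 1 - Pi.single (f v) 1 :
      Matrix V V R).BlockTriangular (OrderDual.toDual ∘ d) := by
    intro v w h
    have h' : d v < d w := h
    rw [key v w h'.le, Matrix.one_apply_ne]
    rintro rfl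
    exact lt_irrefl _ h'
  rw [htri.det]
  refine Finset.prod_eq_one fun k _ => ?_
  convert Matrix.det_one (R := R) (n := {v // (OrderDual.toDual ∘ d) v = k})
  ext v w
  have h : d v = d w := OrderDual.toDual.injective (v.2.trans w.2.symm)
  rw [Matrix.toSquareBlock_def, of_apply, key _ _ h.le]
  simp [Matrix.one_apply, Subtype.ext_iff]

lemma det_parentMatrix_eq_zero [IsDomain R] {r : V} {f : V → V}
    (hf : ¬ ∀ v, ∃ k, f^[k] v = r) :
    det (of fun v => if v = r then Pi.single r 1 else Pi.single v 1 - Pi.single (f v) 1 :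
      Matrix V V R) = 0 := by
  classical
  push Not at hf
  obtain ⟨u, hu⟩ := hf
  refine exists_mulVec_eq_zero_iff.1
    ⟨fun v => if ∃ k, f^[k] v = r then 0 else 1, fun h => ?_, funext fun v => ?_⟩
  · simpa [hu] using congrFun h u
  · have hr : ∃ k, f^[k] r = r := ⟨0, rfl⟩
    by_cases hv : v = r
    · simp [mulVec, hv, hr]
    · have : (∃ k, f^[k] v = r) ↔ ∃ k, f^[k] (f v) = r := by
        constructor
        · rintro ⟨_ | k, hk⟩
          · exact absurd hk hv
          · exact ⟨k, hk⟩
        · rintro ⟨k, hk⟩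
          exact ⟨k + 1, hk⟩
      have h1 : (of fun v => if v = r then Pi.single r 1 else Pi.single v 1 - Pi.single (f v) 1 :
          Matrix V V R) v = Pi.single v 1 - Pi.single (f v) 1 := if_neg hv
      rw [mulVec, h1, sub_dotProduct]
      simp [this]

/-- **Matrix-tree theorem**: the number of spanning trees is a principal cofactor of the
Laplacian. -/
theorem det_updateRow_lapMatrix [IsDomain R] (G : SimpleGraph V) [DecidableRel G.Adj] (r : V) :
    ((G.lapMatrix R).updateRow r (Pi.single r 1)).det =
      Nat.card {T : SimpleGraph V // T ≤ G ∧ T.IsTree} := by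
  classical
  let c : V → V → R := fun v w => if v = r then if w = r then 1 else 0 else
    if G.Adj v w then 1 else 0
  let m : V → V → V → R := fun v w =>
    if v = r then Pi.single r 1 else Pi.single v 1 - Pi.single w 1
  have hrow : (G.lapMatrix R).updateRow r (Pi.single r 1) = fun v => ∑ w, c v w • m v w := by
    funext v
    by_cases hv : v = r
    · subst hv
      simp [c, m]
    · rw [updateRow_ne hv]
      ext j
      simp only [lapMatrix, degMatrix, degree_eq_sum_if_adj, Matrix.sub_apply,
        Matrix.diagonal_apply, adjMatrix_apply, c, m, hv, if_false, Finset.sum_apply, Pi.smul_apply,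
        Pi.sub_apply, Pi.single_apply, smul_eq_mul, mul_sub, Finset.sum_sub_distrib]
      simp [eq_comm (a := j)]
  have hc : ∀ f : V → V,
      ∏ v, c v (f v) = if f r = r ∧ ∀ v, v ≠ r → G.Adj v (f v) then 1 else 0 := by
    intro f
    have : ∀ v, c v (f v) = if (v = r → f v = r) ∧ (v ≠ r → G.Adj v (f v)) then 1 else 0 := by
      intro v
      by_cases hv : v = r <;> simp [c, hv]
    simp_rw [this]
    rw [Finset.prod_ite_zero]
    simp [forall_and]
  have key : ∀ f : V → V, detRowAlternating.toMultilinearMap (fun v => c v (f v) • m v (f v)) =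
      if G.IsParentMap r f then (1 : R) else 0 := by
    intro f
    rw [MultilinearMap.map_smul_univ, hc]
    by_cases h : f r = r ∧ ∀ v, v ≠ r → G.Adj v (f v)
    · by_cases h' : ∀ v, ∃ k, f^[k] v = r
      · rw [if_pos h, if_pos ⟨h.1, h.2, h'⟩, one_smul]
        exact det_parentMatrix_eq_one h'
      · rw [if_pos h, if_neg fun hf => h' hf.reaches, one_smul]
        exact det_parentMatrix_eq_zero h'
    · rw [if_neg h, if_neg fun hf => h ⟨hf.map_root, hf.adj⟩, zero_smul]
  calc _ = detRowAlternating.toMultilinearMap (fun v => ∑ w, c v w • m v w) := by rw [hrow]; rfl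
    _ = ∑ f : V → V, if G.IsParentMap r f then (1 : R) else 0 := by
      rw [MultilinearMap.map_sum]
      exact Finset.sum_congr rfl fun f _ => key f
    _ = _ := by
      rw [card_isTree_eq_card_isParentMap G r, Finset.sum_boole, Nat.card_eq_fintype_card,
        Fintype.card_subtype]

/-- The determinant of the Laplacian shifted by the all-ones matrix counts spanning trees. -/
theorem det_lapMatrix_add_one [IsDomain R] [Nonempty V] (G : SimpleGraph V) [DecidableRel G.Adj] :
    (G.lapMatrix R + of fun _ _ => 1).det =
      (Fintype.card V : R) ^ 2 * Nat.card {T : SimpleGraph V // T ≤ G ∧ T.IsTree} := by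
  obtain ⟨r⟩ := ‹Nonempty V›
  set L := G.lapMatrix R with hL
  set n : R := (Fintype.card V : R) with hn
  have hsum : ∀ v, ∑ w, L v w = 0 := fun v => by
    simpa [mulVec, dotProduct] using congrFun (G.lapMatrix_mulVec_const_eq_zero (R := R)) v
  have hcol : ∀ w, ∑ v, L v w = 0 := fun w => by
    rw [← hsum w]
    exact Finset.sum_congr rfl fun v _ => (G.isSymm_lapMatrix (R := R)).apply w v
  have hrows : (L + of fun _ _ => 1).det = n * (L.updateRow r 1).det := by
    have h1 : ((L + of fun _ _ => 1).updateRow r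
        (∑ k, (1 : V → R) k • fun w => L k w + 1)).det = (1 : V → R) r • _ :=
      det_updateRow_sum (L + of fun _ _ => 1) r 1
    have h2 : (∑ k, (1 : V → R) k • fun w => L k w + 1) = n • (1 : V → R) := by
      ext j
      simp [Finset.sum_apply, Finset.sum_add_distrib, hcol, hn]
    rw [h2, det_updateRow_smul, Pi.one_apply, one_smul] at h1
    rw [← h1]
    congr 1
    refine det_eq_of_forall_row_eq_smul_add_const (fun v => if v = r then 0 else 1) r (by simp) ?_
    intro v w
    by_cases hv : v = r
    · subst hv; simp
    · simp [hv]
  have hrow : (L.updateRow r 1).det = n * (L.updateRow r (Pi.single r 1)).det := by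
    have h1 : (1 : V → R) = (1 - n • Pi.single r 1) + n • Pi.single r 1 := by simp
    rw [h1, det_updateRow_add, det_updateRow_smul, add_eq_right]
    refine exists_mulVec_eq_zero_iff.1 ⟨1, one_ne_zero, funext fun v => ?_⟩
    by_cases hv : v = r
    · subst hv
      simp [mulVec, dotProduct, hn, Finset.sum_sub_distrib, ← Finset.mul_sum]
    · simp [mulVec, dotProduct, hv, hsum]
  rw [hrows, hrow, hL, det_updateRow_lapMatrix]
  ring

end SimpleGraph

variable {F : Type*} [Field F] [Fintype F] [DecidableEq F]

/-- The Jacobsthal matrix `χ (x - y)` of the quadratic character `χ`. -/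
def jacobsthalMatrix (F : Type*) [Field F] [Fintype F] [DecidableEq F] : Matrix F F ℚ :=
  of fun x y => (quadraticChar F (x - y) : ℚ)

lemma sum_quadraticChar_mul_one_sub (hF : ringChar F ≠ 2) :
    ∑ t : F, quadraticChar F t * quadraticChar F (1 - t) = -quadraticChar F (-1) := by
  have h := jacobiSum_nontrivial_inv (quadraticChar_ne_one hF)
  rwa [(quadraticChar_isQuadratic F).inv] at h

lemma jacobsthalMatrix_mul_self (hF : ringChar F ≠ 2) (h1 : quadraticChar F (-1) = 1) :
    jacobsthalMatrix F * jacobsthalMatrix F =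
      (Fintype.card F : ℚ) • (1 : Matrix F F ℚ) - of fun _ _ => 1 := by
  ext x y
  have hsum : ∑ z, quadraticChar F (x - z) * quadraticChar F (z - y) =
      if x = y then (Fintype.card F : ℤ) - 1 else -1 := by
    split_ifs with hxy
    · subst hxy
      have h2 : ∀ z, quadraticChar F (x - z) * quadraticChar F (z - x) =
          1 - if z = x then 1 else 0 := by
        intro z
        split_ifs with hz
        · simp [hz]
        · have h3 : x - z ≠ 0 := sub_ne_zero.2 (Ne.symm hz)
          rw [show z - x = -1 * (x - z) by ring, map_mul, h1, one_mul, ← sq,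
            quadraticChar_sq_one h3, sub_zero]
      simp_rw [h2]
      simp
    · have hd : x - y ≠ 0 := sub_ne_zero.2 hxy
      rw [← h1, ← sum_quadraticChar_mul_one_sub hF]
      refine (Fintype.sum_equiv ((Equiv.mulLeft₀ (x - y) hd).trans (Equiv.addRight y)) _ _
        fun t => ?_).symm
      have e1 : x - ((x - y) * t + y) = (x - y) * (1 - t) := by ring
      have e2 : (x - y) * t + y - y = (x - y) * t := by ring
      change _ = quadraticChar F (x - ((x - y) * t + y)) * quadraticChar F ((x - y) * t + y - y)
      rw [e1, e2, map_mul, map_mul]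
      linear_combination (-quadraticChar F t * quadraticChar F (1 - t)) * quadraticChar_sq_one hd
  have hsum' := congrArg (Int.cast : ℤ → ℚ) hsum
  simp only [jacobsthalMatrix, mul_apply, of_apply, Matrix.sub_apply, Matrix.smul_apply,
    Matrix.one_apply, smul_eq_mul]
  push_cast at hsum'
  rw [hsum']
  split_ifs <;> ring

lemma sum_quadraticChar_sub_left (hF : ringChar F ≠ 2) (x : F) :
    ∑ y, (quadraticChar F (x - y) : ℚ) = 0 := by
  have h : ∑ y, quadraticChar F (x - y) = 0 :=
    ((Equiv.subLeft x).sum_comp (quadraticChar F ·)).trans (quadraticChar_sum_zero hF)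
  exact_mod_cast h

lemma sum_quadraticChar_sub_right (hF : ringChar F ≠ 2) (y : F) :
    ∑ x, (quadraticChar F (x - y) : ℚ) = 0 := by
  have h : ∑ x, quadraticChar F (x - y) = 0 :=
    ((Equiv.subRight y).sum_comp (quadraticChar F ·)).trans (quadraticChar_sum_zero hF)
  exact_mod_cast h

lemma det_smul_one_add_smul_ones {V : Type*} [Fintype V] [DecidableEq V] {a : ℚ} (ha : a ≠ 0)
    (b : ℚ) : (a • (1 : Matrix V V ℚ) + b • of fun _ _ => 1).det =
      a ^ Fintype.card V * (1 + Fintype.card V * b / a) := by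
  have h : a • (1 : Matrix V V ℚ) + b • of (fun _ _ => 1) =
      a • ((1 : Matrix V V ℚ) +
        replicateCol Unit (fun _ : V => b / a) * replicateRow Unit fun _ : V => (1 : ℚ)) := by
    ext i j
    simp [mul_apply, mul_add, mul_div_cancel₀ _ ha]
  rw [h, det_smul, det_one_add_replicateCol_mul_replicateRow]
  simp [dotProduct, mul_div_assoc]

/-- Multiplication by a nonsquare exchanges the two signs of the Jacobsthal matrix. -/
lemma det_add_jacobsthalMatrix (hF : ringChar F ≠ 2) (a b : ℚ) :
    (a • (1 : Matrix F F ℚ) + b • of (fun _ _ => 1) + jacobsthalMatrix F).det =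
      (a • (1 : Matrix F F ℚ) + b • of (fun _ _ => 1) - jacobsthalMatrix F).det := by
  obtain ⟨n, hn⟩ := quadraticChar_exists_neg_one hF
  have hn0 : n ≠ 0 := by
    rintro rfl
    simp at hn
  rw [← det_submatrix_equiv_self (Equiv.mulLeft₀ n hn0)]
  congr 1
  ext x y
  have h : quadraticChar F (n * x - n * y) = -quadraticChar F (x - y) := by
    rw [← mul_sub, map_mul, hn, neg_one_mul]
  simp only [submatrix_apply, Equiv.mulLeft₀_apply, Matrix.add_apply, Matrix.sub_apply,
    Matrix.smul_apply, Matrix.one_apply, of_apply, jacobsthalMatrix, h, mul_right_inj' hn0]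
  push_cast
  ring

lemma lapMatrix_paley (hF : ringChar F ≠ 2)
    (G : SimpleGraph F) [DecidableRel G.Adj]
    (hG : ∀ x y : F, G.Adj x y ↔ x ≠ y ∧ IsSquare (x - y)) :
    G.lapMatrix ℚ + of (fun _ _ => 1) =
      (2⁻¹ : ℚ) • ((Fintype.card F : ℚ) • (1 : Matrix F F ℚ) + (1 : ℚ) • of (fun _ _ => 1) -
        jacobsthalMatrix F) := by
  have hadj : ∀ x y : F, (if G.Adj x y then (1 : ℚ) else 0) =
      (1 - (if x = y then 1 else 0) + quadraticChar F (x - y)) / 2 := by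
    intro x y
    by_cases hxy : x = y
    · simp [hxy]
    · have hd : x - y ≠ 0 := sub_ne_zero.2 hxy
      by_cases hs : IsSquare (x - y)
      · rw [(quadraticChar_one_iff_isSquare hd).2 hs, if_pos ((hG x y).2 ⟨hxy, hs⟩)]
        simp [hxy]
      · rw [quadraticChar_neg_one_iff_not_isSquare.2 hs, if_neg fun h => hs ((hG x y).1 h).2]
        simp [hxy]
  have hdeg : ∀ x : F, (G.degree x : ℚ) = (Fintype.card F - 1) / 2 := by
    intro x
    rw [G.degree_eq_sum_if_adj]
    simp_rw [hadj]
    rw [← Finset.sum_div, Finset.sum_add_distrib, sum_quadraticChar_sub_left hF]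
    simp
  ext x y
  simp only [SimpleGraph.lapMatrix, SimpleGraph.degMatrix, Matrix.add_apply, Matrix.sub_apply,
    Matrix.diagonal_apply, SimpleGraph.adjMatrix_apply, hadj, hdeg, Matrix.smul_apply,
    Matrix.one_apply, of_apply, jacobsthalMatrix, smul_eq_mul]
  split_ifs <;> ring

lemma det_lapMatrix_paley_sq (h1 : quadraticChar F (-1) = 1) (hF : ringChar F ≠ 2)
    (G : SimpleGraph F) [DecidableRel G.Adj]
    (hG : ∀ x y : F, G.Adj x y ↔ x ≠ y ∧ IsSquare (x - y)) :
    (G.lapMatrix ℚ + of (fun _ _ => 1)).det ^ 2 = (Fintype.card F : ℚ) ^ 2 *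
      (Fintype.card F * ((Fintype.card F - 1) / 4)) ^ (Fintype.card F - 1) := by
  set q : ℚ := (Fintype.card F : ℚ) with hq
  set J : Matrix F F ℚ := of fun _ _ => 1 with hJ
  set S := jacobsthalMatrix F with hS
  have hq1 : 1 < q := by
    rw [hq]
    exact_mod_cast Fintype.one_lt_card
  have hJJ : J * J = q • J := by
    ext
    simp [hJ, mul_apply, hq]
  have hSJ : S * J = 0 := by
    ext x y
    simpa [hS, hJ, mul_apply, jacobsthalMatrix] using sum_quadraticChar_sub_left hF x
  have hJS : J * S = 0 := by
    ext x y
    simpa [hS, hJ, mul_apply, jacobsthalMatrix] using sum_quadraticChar_sub_right hF y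
  have hprod : (2⁻¹ : ℚ) • (q • 1 + (1 : ℚ) • J - S) * ((2⁻¹ : ℚ) • (q • 1 + (1 : ℚ) • J + S)) =
      (q * (q - 1) / 4) • (1 : Matrix F F ℚ) + ((3 * q + 1) / 4) • J := by
    have hSS := jacobsthalMatrix_mul_self hF h1
    rw [← hS, ← hJ, ← hq] at hSS
    simp only [sub_mul, add_mul, mul_add, hJJ, hSJ, hJS, hSS, one_mul, mul_one,
      smul_mul_assoc, mul_smul_comm]
    module
  have hdet := congrArg det hprod
  have hswap : ((2⁻¹ : ℚ) • (q • 1 + (1 : ℚ) • J + S)).det =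
      ((2⁻¹ : ℚ) • (q • 1 + (1 : ℚ) • J - S)).det := by
    rw [det_smul, det_smul, hS, hJ, det_add_jacobsthalMatrix hF]
  rw [det_mul, hswap, ← lapMatrix_paley hF G hG, ← sq,
    det_smul_one_add_smul_ones (by have := sub_pos.2 hq1; positivity)] at hdet
  rw [hdet]
  obtain ⟨m, hm⟩ : ∃ m, Fintype.card F = m + 1 :=
    Nat.exists_eq_succ_of_ne_zero Fintype.card_ne_zero
  have hq1' : q - 1 ≠ 0 := (sub_pos.2 hq1).ne'
  rw [← hq, hm, Nat.add_sub_cancel, pow_succ, ← mul_div_assoc q]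
  field_simp
  ring

end

/-- The number of spanning trees of the Paley graph `P(q)` equals
`q^{(q-3)/2} · μ^{(q-1)/2}`, where `μ = (q-1)/4`. -/
theorem paley_spanning_tree_count
    (q : ℕ) (hq : IsPrimePow q) (hq4 : q % 4 = 1)
    (F : Type*) [Field F] [Fintype F]
    (hcard : Fintype.card F = q)
    (G : SimpleGraph F)
    (hG : ∀ x y : F, G.Adj x y ↔ x ≠ y ∧ IsSquare (x - y)) :
    Nat.card {H : G.Subgraph // H.IsSpanning ∧ H.coe.IsTree} =
      q ^ ((q - 3) / 2) * ((q - 1) / 4) ^ ((q - 1) / 2) := by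
  classical
  have hF : ringChar F ≠ 2 := fun h => by
    have := FiniteField.even_card_iff_char_two.1 h
    lia
  have h1 : quadraticChar F (-1) = 1 :=
    (quadraticChar_one_iff_isSquare (neg_ne_zero.2 one_ne_zero)).2
      (FiniteField.isSquare_neg_one_iff.2 (by lia))
  rw [SimpleGraph.card_isSpanning_isTree]
  have h := det_lapMatrix_paley_sq h1 hF G hG
  rw [SimpleGraph.det_lapMatrix_add_one, hcard] at h
  set t := Nat.card {T : SimpleGraph F // T ≤ G ∧ T.IsTree}
  obtain ⟨m, rfl⟩ : ∃ m, q = 4 * (m + 1) + 1 := by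
    have := hq.one_lt
    exact ⟨q / 4 - 1, by lia⟩
  have e1 : (4 * (m + 1) + 1 - 3) / 2 = 2 * m + 1 := by lia
  have e2 : (4 * (m + 1) + 1 - 1) / 4 = m + 1 := by lia
  have e3 : (4 * (m + 1) + 1 - 1) / 2 = 2 * m + 2 := by lia
  have e4 : 4 * (m + 1) + 1 - 1 = 4 * m + 4 := by lia
  have e5 : (((4 * (m + 1) + 1 : ℕ) : ℚ) - 1) / 4 = ((m + 1 : ℕ) : ℚ) := by
    push_cast
    ring
  rw [e1, e2, e3]
  rw [e4, e5] at h
  norm_cast at h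
  set n := 4 * (m + 1) + 1 with hn
  have hsq : n ^ 4 * t ^ 2 = n ^ 4 * (n ^ (2 * m + 1) * (m + 1) ^ (2 * m + 2)) ^ 2 :=
    calc n ^ 4 * t ^ 2 = (n ^ 2 * t) ^ 2 := by ring
      _ = _ := h
      _ = _ := by
        rw [mul_pow]
        ring
  exact Nat.pow_left_injective two_ne_zero (Nat.eq_of_mul_eq_mul_left (by positivity) hsq)
end

section
/- The p-complementary part of the critical group of the Paley graph P(q), q = p^t, is isomorphic to (Z/μZ)^{2μ}, where μ=(q-1)/4. -/
open scoped TensorProduct in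
theorem nonempty_basis_of_prod_self_prod_equiv {R P ι : Type*} [CommRing R]
    [Finite (MaximalSpectrum R)] [AddCommGroup P] [Module R P] [Fintype ι]
    (e : (ι → R) ≃ₗ[R] P × P × R) (n : ℕ) (hn : Fintype.card ι = 2 * n + 1) :
    Nonempty (Module.Basis (Fin n) R P) := by
  classical
  have hproj : Module.Projective R P := by
    refine Module.Projective.of_split (P := P) (M := ι → R)
      (e.symm.toLinearMap ∘ₗ LinearMap.inl R P (P × R)) (LinearMap.fst R P (P × R) ∘ₗ e.toLinearMap) ?_
    ext x
    simp
  have hfin : Module.Finite R P :=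
    Module.Finite.of_surjective (LinearMap.fst R P (P × R) ∘ₗ e.toLinearMap)
      ((LinearMap.fst_surjective (R := R) (M := P) (M₂ := P × R)).comp e.surjective)
  refine Module.nonempty_basis_of_flat_of_finrank_eq R P n fun M => ?_
  let := Ideal.Quotient.field M.1
  have e1 := e.baseChange R (R ⧸ M.1) _ _
  have e2 := (e1.trans (TensorProduct.prodRight R (R ⧸ M.1) (R ⧸ M.1) P (P × R))).trans
    ((LinearEquiv.refl (R ⧸ M.1) _).prodCongr
      (TensorProduct.prodRight R (R ⧸ M.1) (R ⧸ M.1) P R))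
  have h := e2.finrank_eq
  have : Nontrivial R := (Ideal.Quotient.mk M.1).domain_nontrivial
  have h1 : Module.finrank (R ⧸ M.1) ((R ⧸ M.1) ⊗[R] (ι → R)) = 2 * n + 1 := by
    rw [Module.finrank_baseChange, Module.finrank_pi, hn]
  have h2 : Module.finrank (R ⧸ M.1) ((R ⧸ M.1) ⊗[R] R) = 1 := by
    rw [Module.finrank_baseChange, Module.finrank_self]
  rw [Module.finrank_prod, Module.finrank_prod, h1, h2] at h
  omega

theorem quadraticChar_conv {F : Type*} [Field F] [Fintype F] [DecidableEq F]
    (hF : Fintype.card F % 4 = 1) (c : F) :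
    ∑ w : F, quadraticChar F (c - w) * quadraticChar F w =
      (if c = 0 then (Fintype.card F : ℤ) else 0) - 1 := by
  have h2 : ringChar F ≠ 2 := by
    intro h
    have := FiniteField.even_card_of_char_two h
    omega
  have hneg : quadraticChar F (-1) = 1 :=
    (quadraticChar_one_iff_isSquare (neg_ne_zero.mpr one_ne_zero)).mpr
      (FiniteField.isSquare_neg_one_iff.mpr (by omega))
  split_ifs with hc
  · subst hc
    have h : ∀ w : F, quadraticChar F (0 - w) * quadraticChar F w = 1 - if w = 0 then 1 else 0 := by
      intro w
      rw [zero_sub, neg_eq_neg_one_mul, map_mul, hneg, one_mul]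
      split_ifs with hw
      · simp [hw]
      · rw [← sq, quadraticChar_sq_one hw, sub_zero]
    rw [Finset.sum_congr rfl fun w _ => h w]
    simp
  · have h := jacobiSum_nontrivial_inv (quadraticChar_ne_one h2)
    rw [(quadraticChar_isQuadratic F).inv, hneg, jacobiSum] at h
    rw [zero_sub, ← h, ← Equiv.sum_comp (Equiv.mulLeft₀ c hc)]
    refine Finset.sum_congr rfl fun u _ => ?_
    have : c - c * u = c * (1 - u) := by ring
    change quadraticChar F (c - c * u) * quadraticChar F (c * u) = _
    simp only [this, map_mul]
    linear_combination (quadraticChar F (1 - u) * quadraticChar F u) * quadraticChar_sq_one hc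

theorem paley_laplacian_properties {F : Type*} [Field F] [Fintype F] [DecidableEq F]
    [DecidablePred (IsSquare : F → Prop)] (m : ℕ) (hm : Fintype.card F = 4 * m + 1)
    (L : Matrix F F ℤ)
    (hL : ∀ x y : F, L x y = (if x = y then 2 * (m : ℤ) else 0) -
        (if x ≠ y ∧ IsSquare (x - y) then 1 else 0)) :
    (∀ x, ∑ y, L x y = 0) ∧ (∀ y, ∑ x, L x y = 0) ∧
    (∀ x y, ∑ z, L x z * L z y = (4 * m + 1) * L x y -
      (if x = y then (m : ℤ) * (4 * m + 1) else 0) + (m : ℤ)) ∧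
    ∃ σ : F ≃ F, ∀ x y,
      L (σ x) (σ y) = (if x = y then 4 * (m : ℤ) + 1 else 0) - 1 - L x y := by
  have h2 : ringChar F ≠ 2 := by
    intro h
    have := FiniteField.even_card_of_char_two h
    omega
  have key : ∀ x y, 2 * L x y =
      (if x = y then 4 * (m : ℤ) + 1 else 0) - 1 - quadraticChar F (x - y) := by
    intro x y
    rw [hL]
    by_cases h : x = y
    · subst h; simp; ring
    · have h' : x - y ≠ 0 := sub_ne_zero.mpr h
      by_cases hs : IsSquare (x - y)
      · simp [h, hs, (quadraticChar_one_iff_isSquare h').mpr hs]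
      · simp [h, hs, quadraticChar_neg_one_iff_not_isSquare.mpr hs]
  have hcard : (Fintype.card F : ℤ) = 4 * m + 1 := by rw [hm]; push_cast; ring
  have s1 : ∀ x, ∑ y, quadraticChar F (x - y) = 0 := fun x => by
    rw [← quadraticChar_sum_zero h2,
      ← (Equiv.subLeft x).sum_comp fun a => quadraticChar F a]; rfl
  have s2 : ∀ y, ∑ x, quadraticChar F (x - y) = 0 := fun y => by
    rw [← quadraticChar_sum_zero h2,
      ← (Equiv.subRight y).sum_comp fun a => quadraticChar F a]; rfl
  have conv : ∀ x y, ∑ z, quadraticChar F (x - z) * quadraticChar F (z - y) =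
      (if x = y then 4 * (m : ℤ) + 1 else 0) - 1 := fun x y => by
    have := quadraticChar_conv (by omega) (x - y)
    rw [← (Equiv.subRight y).sum_comp] at this
    simpa [sub_eq_zero, hcard] using this
  refine ⟨fun x => ?_, fun y => ?_, fun x y => ?_, ?_⟩
  · have : 2 * ∑ y, L x y = 0 := by
      simp [-quadraticChar_apply, Finset.mul_sum, key, Finset.sum_sub_distrib, s1, hcard]
    omega
  · have : 2 * ∑ x, L x y = 0 := by
      simp [-quadraticChar_apply, Finset.mul_sum, key, Finset.sum_sub_distrib, s2, hcard]
    omega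
  · have h4 : 4 * ∑ z, L x z * L z y = ∑ z, (2 * L x z) * (2 * L z y) := by
      rw [Finset.mul_sum]; exact Finset.sum_congr rfl fun z _ => by ring
    have hk := key x y
    simp only [key, sub_mul, mul_sub, Finset.sum_sub_distrib, conv, mul_one, one_mul, s1, s2,
      ite_mul, mul_ite, zero_mul, mul_zero, Finset.sum_ite_eq, Finset.sum_ite_eq',
      Finset.mem_univ, if_true, Finset.sum_const, Finset.card_univ, nsmul_eq_mul, hcard] at h4
    split_ifs at hk h4 ⊢ <;> nlinarith
  · obtain ⟨g, hg⟩ := quadraticChar_exists_neg_one' h2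
    refine ⟨Equiv.mulLeft₀ (g : F) g.ne_zero, fun x y => ?_⟩
    have h := key (g * x) (g * y)
    have h' := key x y
    rw [← mul_sub, map_mul, hg] at h
    simp only [mul_right_inj' g.ne_zero] at h
    change L (g * x) (g * y) = _
    split_ifs at * <;> omega

theorem nonempty_basis_range_of_complementary {R ι : Type*} [CommRing R]
    [Finite (MaximalSpectrum R)] [Fintype ι] (n : ℕ) (hn : Fintype.card ι = 2 * n + 1)
    (a b : (ι → R) →ₗ[R] (ι → R)) (s : (ι → R) →ₗ[R] R) (τ : (ι → R) ≃ₗ[R] (ι → R))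
    (hab : ∀ x, a (b x) = 0) (hba : ∀ x, b (a x) = 0)
    (hadd : ∀ x, a x + b x + (fun _ => s x) = x)
    (hac : ∀ r : R, a (fun _ => r) = 0) (hbc : ∀ r : R, b (fun _ => r) = 0)
    (hsa : ∀ x, s (a x) = 0) (hsb : ∀ x, s (b x) = 0) (hsc : ∀ r : R, s (fun _ => r) = r)
    (hτ : ∀ x, b (τ x) = τ (a x)) :
    Nonempty (Module.Basis (Fin n) R (LinearMap.range b)) := by
  have haa : ∀ x, a (a x) = a x := fun x => by
    conv_rhs => rw [← hadd x]
    rw [map_add, map_add, hab, hac, add_zero, add_zero]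
  have hbb : ∀ x, b (b x) = b x := fun x => by
    conv_rhs => rw [← hadd x]
    rw [map_add, map_add, hba, hbc, add_zero, zero_add]
  have hmap : (LinearMap.range a).map (τ : (ι → R) →ₗ[R] (ι → R)) = LinearMap.range b := by
    ext y
    constructor
    · rintro ⟨_, ⟨x, rfl⟩, rfl⟩
      exact ⟨τ x, hτ x⟩
    · rintro ⟨x, rfl⟩
      refine ⟨a (τ.symm x), ⟨_, rfl⟩, ?_⟩
      have := hτ (τ.symm x)
      rw [τ.apply_symm_apply] at this
      exact this.symm
  let g : (ι → R) →ₗ[R] LinearMap.range a × LinearMap.range b × R :=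
    a.rangeRestrict.prod (b.rangeRestrict.prod s)
  have hg : Function.Bijective g := by
    constructor
    · rw [injective_iff_map_eq_zero]
      intro x hx
      have h1 : a x = 0 := congrArg (fun z => (z.1 : ι → R)) hx
      have h2 : b x = 0 := congrArg (fun z => (z.2.1 : ι → R)) hx
      have h3 : s x = 0 := congrArg (fun z => z.2.2) hx
      rw [← hadd x, h1, h2, h3]
      ext
      simp
    · rintro ⟨⟨_, u, rfl⟩, ⟨_, v, rfl⟩, r⟩
      refine ⟨a u + b v + fun _ => r, Prod.ext (Subtype.ext ?_) (Prod.ext (Subtype.ext ?_) ?_)⟩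
      · change a (a u + b v + fun _ => r) = a u
        rw [map_add, map_add, haa, hab, hac, add_zero, add_zero]
      · change b (a u + b v + fun _ => r) = b v
        rw [map_add, map_add, hba, hbb, hbc, zero_add, add_zero]
      · change s (a u + b v + fun _ => r) = r
        rw [map_add, map_add, hsa, hsb, hsc, zero_add, zero_add]
  exact nonempty_basis_of_prod_self_prod_equiv ((LinearEquiv.ofBijective g hg).trans
    ((LinearEquiv.ofSubmodules τ _ _ hmap).prodCongr (LinearEquiv.refl R _))) n hn

theorem nonempty_addEquiv_ker_prod {K P : Type*} [AddCommGroup K] [AddCommGroup P] (f : K →+ P)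
    (hf : Function.Surjective f) (n : ℤ) (hP : ∀ w : P, n • w = w)
    (hker : ∀ x, f x = 0 → n • x = 0) : Nonempty (K ≃+ f.ker × P) := by
  have hmem : ∀ x, x - n • x ∈ f.ker := fun x => by
    rw [AddMonoidHom.mem_ker, map_sub, map_zsmul, hP, sub_self]
  let g : K →+ f.ker × P :=
    (((AddMonoidHom.id K - zsmulAddGroupHom n).codRestrict f.ker hmem).prod f)
  refine ⟨AddEquiv.ofBijective g ⟨?_, ?_⟩⟩
  · rw [injective_iff_map_eq_zero]
    intro x hx
    have h1 : x - n • x = 0 := congrArg (fun z => (z.1 : K)) hx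
    have h2 : f x = 0 := congrArg Prod.snd hx
    rwa [hker x h2, sub_zero] at h1
  · rintro ⟨⟨k, hk⟩, w⟩
    obtain ⟨x, rfl⟩ := hf w
    refine ⟨n • x + k, Prod.ext (Subtype.ext ?_) ?_⟩
    · change n • x + k - n • (n • x + k) = k
      have h := hker _ (hmem x)
      rw [smul_sub, sub_eq_zero] at h
      rw [smul_add, hker k hk, ← h]
      abel
    · change f (n • x + k) = f x
      rw [map_add, map_zsmul, hP, AddMonoidHom.mem_ker.mp hk, add_zero]

theorem mulVec_intCast_properties {F R : Type*} [Fintype F] [DecidableEq F] [CommRing R] (m : ℕ)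
    (L : Matrix F F ℤ) (hrow : ∀ x, ∑ y, L x y = 0) (hcol : ∀ y, ∑ x, L x y = 0)
    (hsq : ∀ x y, ∑ z, L x z * L z y = (4 * m + 1) * L x y -
      (if x = y then (m : ℤ) * (4 * m + 1) else 0) + (m : ℤ))
    (σ : F ≃ F)
    (hσ : ∀ x y, L (σ x) (σ y) = (if x = y then 4 * (m : ℤ) + 1 else 0) - 1 - L x y)
    (x : F → R) :
    ∑ i, (L.map (Int.cast : ℤ → R)).mulVec x i = 0 ∧
    (∀ r : R, (L.map (Int.cast : ℤ → R)).mulVec (fun _ => r) = 0) ∧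
    (∀ i, (L.map (Int.cast : ℤ → R)).mulVec ((L.map (Int.cast : ℤ → R)).mulVec x) i =
      (4 * m + 1) * (L.map (Int.cast : ℤ → R)).mulVec x i - m * (4 * m + 1) * x i +
        m * ∑ j, x j) ∧
    (∀ i, (L.map (Int.cast : ℤ → R)).mulVec x (σ i) = (4 * m + 1) * x (σ i) - ∑ j, x j -
      (L.map (Int.cast : ℤ → R)).mulVec (x ∘ σ) i) := by
  have hcast : ∀ i j, ((∑ z, L i z * L z j : ℤ) : R) = (4 * m + 1) * L i j -
      (if i = j then (m : R) * (4 * m + 1) else 0) + m := fun i j => by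
    rw [hsq]; push_cast; rfl
  have hσ' : ∀ i j, (L (σ i) (σ j) : R) =
      (if i = j then 4 * (m : R) + 1 else 0) - 1 - L i j := fun i j => by
    rw [hσ]; push_cast; rfl
  refine ⟨?_, fun r => ?_, fun i => ?_, fun i => ?_⟩
  · simp only [Matrix.mulVec, dotProduct, Matrix.map_apply]
    rw [Finset.sum_comm]
    refine Finset.sum_eq_zero fun j _ => ?_
    rw [← Finset.sum_mul, ← Int.cast_sum, hcol, Int.cast_zero, zero_mul]
  · ext i
    simp only [Matrix.mulVec, dotProduct, Matrix.map_apply, Pi.zero_apply]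
    rw [← Finset.sum_mul, ← Int.cast_sum, hrow, Int.cast_zero, zero_mul]
  · rw [Matrix.mulVec_mulVec]
    have : ∀ j, ((L.map (Int.cast : ℤ → R)) * (L.map (Int.cast : ℤ → R))) i j =
        ((∑ z, L i z * L z j : ℤ) : R) := fun j => by
      simp [Matrix.mul_apply]
    simp only [Matrix.mulVec, dotProduct, this, hcast, Matrix.map_apply]
    simp only [add_mul _ _ (x _), sub_mul _ _ (x _), Finset.sum_add_distrib,
      Finset.sum_sub_distrib, ite_mul, zero_mul, Finset.sum_ite_eq, Finset.mem_univ, if_true,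
      Finset.mul_sum, mul_assoc]
  · simp only [Matrix.mulVec, dotProduct, Matrix.map_apply, Function.comp_apply]
    rw [← σ.sum_comp, ← σ.sum_comp x]
    simp only [hσ', sub_mul, Finset.sum_sub_distrib, ite_mul, zero_mul, one_mul,
      Finset.sum_ite_eq, Finset.mem_univ, if_true]

theorem nonempty_addEquiv_torsion_coker {F : Type*} [Fintype F] [DecidableEq F] (p t m : ℕ)
    (hp : p.Prime) (hpt : 4 * m + 1 = p ^ t) (ht : 1 ≤ t) (hm0 : m ≠ 0)
    (hm : Fintype.card F = 4 * m + 1)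
    (L : Matrix F F ℤ) (hrow : ∀ x, ∑ y, L x y = 0) (hcol : ∀ y, ∑ x, L x y = 0)
    (hsq : ∀ x y, ∑ z, L x z * L z y = (4 * m + 1) * L x y -
      (if x = y then (m : ℤ) * (4 * m + 1) else 0) + (m : ℤ))
    (σ : F ≃ F)
    (hσ : ∀ x y, L (σ x) (σ y) = (if x = y then 4 * (m : ℤ) + 1 else 0) - 1 - L x y) :
    ∃ Kp : AddSubgroup
        (Submodule.torsion ℤ ((F → ℤ) ⧸ LinearMap.range (Matrix.toLin' L))),
      (∀ x, x ∈ Kp ↔ ∃ n : ℕ, (p ^ n : ℕ) • x = 0) ∧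
      Nonempty
        ((Submodule.torsion ℤ ((F → ℤ) ⧸ LinearMap.range (Matrix.toLin' L))) ≃+
          (Kp × (Fin (2 * m) → ZMod m))) := by
  have : NeZero m := ⟨hm0⟩
  have hmR : (m : ZMod m) = 0 := ZMod.natCast_self m
  have hcardR : (Fintype.card F : ZMod m) = 1 := by rw [hm]; push_cast; simp
  -- the integral identities
  have hZ := fun x : F → ℤ => mulVec_intCast_properties m L hrow hcol hsq σ hσ x
  have hLZ : L.map (Int.cast : ℤ → ℤ) = L := by ext; simp
  simp only [hLZ] at hZ
  -- the identities modulo `m`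
  have hR := fun x : F → ZMod m => mulVec_intCast_properties m L hrow hcol hsq σ hσ x
  simp only [hmR, mul_zero, zero_add, one_mul, zero_mul, sub_zero, add_zero] at hR
  let a : (F → ZMod m) →ₗ[ZMod m] (F → ZMod m) := Matrix.toLin' (L.map (Int.cast : ℤ → ZMod m))
  let s : (F → ZMod m) →ₗ[ZMod m] ZMod m := ∑ i, LinearMap.proj i
  let b : (F → ZMod m) →ₗ[ZMod m] (F → ZMod m) :=
    LinearMap.id - LinearMap.pi (fun _ => s) - a
  have hs : ∀ x, s x = ∑ i, x i := fun x => by simp [s]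
  have hb : ∀ x i, b x i = x i - ∑ j, x j - a x i := fun x i => by rw [← hs]; rfl
  have hb' : ∀ x, b x = x - (fun _ => s x) - a x := fun x => rfl
  have hsa : ∀ x, s (a x) = 0 := fun x => (hs _).trans (hR x).1
  have hac : ∀ r : ZMod m, a (fun _ => r) = 0 := (hR 0).2.1
  have haa : ∀ x, a (a x) = a x := fun x => funext (hR x).2.2.1
  have hsc : ∀ r : ZMod m, s (fun _ => r) = r := fun r => by simp [hs, hcardR]
  have hab : ∀ x, a (b x) = 0 := fun x => by
    rw [hb', map_sub, map_sub, hac, haa, sub_zero, sub_self]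
  have hba : ∀ x, b (a x) = 0 := fun x => by
    rw [hb', hsa, haa]; ext; simp
  have hsb : ∀ x, s (b x) = 0 := fun x => by
    rw [hb', map_sub, map_sub, hsc, hsa, sub_zero, sub_self]
  have hbc : ∀ r : ZMod m, b (fun _ => r) = 0 := fun r => by
    rw [hb', hsc, hac, sub_zero, sub_self]
  obtain ⟨B⟩ := nonempty_basis_range_of_complementary (2 * m) (by omega) a b s
    (LinearEquiv.funCongrLeft (ZMod m) (ZMod m) σ) hab hba (fun x => by rw [hb']; abel)
    hac hbc hsa hsb hsc (fun x => by
      ext i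
      have h := (hR x).2.2.2 i
      rw [hb]
      change x (σ i) - ∑ j, x (σ j) - (L.map (Int.cast : ℤ → ZMod m)).mulVec (x ∘ σ) i =
        (L.map (Int.cast : ℤ → ZMod m)).mulVec x (σ i)
      rw [h, σ.sum_comp x])
  -- the reduction map from the cokernel
  let c : (F → ℤ) →ₗ[ℤ] (F → ZMod m) := (Int.castAddHom (ZMod m)).toIntLinearMap.compLeft F
  have hc : ∀ x i, c x i = (x i : ZMod m) := fun x i => rfl
  have hac' : ∀ x, a (c x) = c (L.mulVec x) := fun x => by
    ext i
    rw [hc]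
    change (L.map (Int.cast : ℤ → ZMod m)).mulVec (c x) i = _
    simp [Matrix.mulVec, dotProduct, hc]
  have hsc' : ∀ x, s (c x) = ((∑ i, x i : ℤ) : ZMod m) := fun x => by simp [hs, hc]
  let φ : (F → ℤ) →ₗ[ℤ] LinearMap.range b := (b.rangeRestrict.toAddMonoidHom.toIntLinearMap) ∘ₗ c
  have hφ : ∀ x, (φ x : F → ZMod m) = b (c x) := fun x => rfl
  have hle : LinearMap.range (Matrix.toLin' L) ≤ LinearMap.ker φ := by
    rintro _ ⟨z, rfl⟩
    rw [LinearMap.mem_ker]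
    refine Subtype.ext ?_
    rw [hφ, Matrix.toLin'_apply, ← hac', hba]; rfl
  let Φ := (LinearMap.range (Matrix.toLin' L)).liftQ φ hle
  have hΦ : ∀ x, Φ (Submodule.Quotient.mk x) = φ x := fun x => rfl
  -- `m * q` kills every class of coordinate sum zero
  have hkill : ∀ x : F → ℤ, ∑ i, x i = 0 →
      ((m : ℤ) * (4 * m + 1)) • (Submodule.Quotient.mk x :
        (F → ℤ) ⧸ LinearMap.range (Matrix.toLin' L)) = 0 := fun x hx => by
    rw [← Submodule.Quotient.mk_smul, Submodule.Quotient.mk_eq_zero]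
    refine ⟨(4 * (m : ℤ) + 1) • x - L.mulVec x, ?_⟩
    ext i
    have h := (hZ x).2.2.1 i
    rw [Matrix.toLin'_apply, Matrix.mulVec_sub, Matrix.mulVec_smul]
    simp only [Pi.sub_apply, Pi.smul_apply, smul_eq_mul, h, hx]
    ring
  have htors : ∀ x : F → ℤ, (Submodule.Quotient.mk x :
      (F → ℤ) ⧸ LinearMap.range (Matrix.toLin' L)) ∈ Submodule.torsion ℤ _ ↔ ∑ i, x i = 0 := by
    intro x
    rw [Submodule.mem_torsion_iff]
    constructor
    · rintro ⟨n, hn⟩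
      have hn' : (Submodule.Quotient.mk ((n : ℤ) • x) :
        (F → ℤ) ⧸ LinearMap.range (Matrix.toLin' L)) = 0 := hn
      rw [Submodule.Quotient.mk_eq_zero] at hn'
      obtain ⟨z, hz⟩ := hn'
      have h := (hZ z).1
      rw [← Matrix.toLin'_apply, hz] at h
      simp only [Pi.smul_apply, smul_eq_mul, ← Finset.mul_sum] at h
      exact (mul_eq_zero.mp h).resolve_left (nonZeroDivisors.ne_zero n.2)
    · intro hx
      refine ⟨⟨(m : ℤ) * (4 * m + 1), mem_nonZeroDivisors_of_ne_zero ?_⟩, hkill x hx⟩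
      have : (m : ℤ) ≠ 0 := by exact_mod_cast hm0
      have : (4 * m + 1 : ℤ) ≠ 0 := by omega
      positivity
  let Ψ : Submodule.torsion ℤ ((F → ℤ) ⧸ LinearMap.range (Matrix.toLin' L)) →+
      LinearMap.range b := (Φ ∘ₗ Submodule.subtype _).toAddMonoidHom
  have hΨ : ∀ x, Ψ x = Φ x := fun x => rfl
  have hmP : ∀ w : LinearMap.range b, (m : ℤ) • w = 0 := fun w => by
    refine Subtype.ext (funext fun i => ?_)
    change (m : ℤ) • (w : F → ZMod m) i = 0
    rw [zsmul_eq_mul, Int.cast_natCast, hmR, zero_mul]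
  have hsurj : Function.Surjective Ψ := by
    rintro ⟨_, u, rfl⟩
    choose x hx using fun i => ZMod.intCast_surjective (u i)
    have hcx : c x = u := funext hx
    have hy : ∑ i, ((4 * (m : ℤ) + 1) • x - fun _ => ∑ j, x j : F → ℤ) i = 0 := by
      simp [Finset.sum_sub_distrib, ← Finset.mul_sum, hm]
    refine ⟨⟨_, (htors _).mpr hy⟩, ?_⟩
    rw [hΨ]
    refine Subtype.ext ?_
    change (φ _ : F → ZMod m) = b u
    rw [hφ]
    have : c ((4 * (m : ℤ) + 1) • x - fun _ => ∑ j, x j) = u - fun _ => s u := by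
      ext i
      rw [← hcx, hsc']
      simp [hc]
    rw [this, map_sub, hbc, sub_zero]
  have hker : ∀ x, Ψ x = 0 → ((4 * (m : ℤ) + 1) ^ 2) • x = 0 := by
    rintro ⟨x, hx⟩ h
    induction x using Submodule.Quotient.induction_on with
    | H x =>
    have hx0 := (htors x).mp hx
    have hbx : b (c x) = 0 := congrArg Subtype.val h
    have hz : ∀ i, ∃ z, (4 * (m : ℤ) + 1) * x i - L.mulVec x i = m * z := fun i => by
      have h1 := congrFun hbx i
      rw [hb', hac', hsc', hx0] at h1
      refine (ZMod.intCast_zmod_eq_zero_iff_dvd _ m).mp ?_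
      simpa [hc] using h1
    choose z hz using hz
    have hz0 : ∑ i, z i = 0 := by
      have h1 : (m : ℤ) * ∑ i, z i = 0 := by
        rw [Finset.mul_sum, ← Finset.sum_congr rfl fun i _ => hz i, Finset.sum_sub_distrib,
          ← Finset.mul_sum, hx0, (hZ x).1]
        simp
      exact (mul_eq_zero.mp h1).resolve_left (by exact_mod_cast hm0)
    refine Subtype.ext ?_
    change ((4 * (m : ℤ) + 1) ^ 2) • (Submodule.Quotient.mk x :
      (F → ℤ) ⧸ LinearMap.range (Matrix.toLin' L)) = 0
    have h1 : (4 * (m : ℤ) + 1) • x = Matrix.toLin' L x + (m : ℤ) • z := by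
      ext i
      simp only [Pi.smul_apply, Pi.add_apply, smul_eq_mul, ← hz, Matrix.toLin'_apply]
      ring
    have h2 : (4 * (m : ℤ) + 1) • (Submodule.Quotient.mk x :
        (F → ℤ) ⧸ LinearMap.range (Matrix.toLin' L)) = (m : ℤ) • Submodule.Quotient.mk z := by
      rw [← Submodule.Quotient.mk_smul, h1, Submodule.Quotient.mk_add,
        (Submodule.Quotient.mk_eq_zero _).mpr (LinearMap.mem_range_self _ x), zero_add, Submodule.Quotient.mk_smul]
    rw [sq, mul_smul, h2, smul_smul, mul_comm, hkill z hz0]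
  have hq : ((p ^ t : ℕ) : ℤ) = 4 * m + 1 := by rw [← hpt]; push_cast; ring
  have hcop : Nat.Coprime p m := by
    rw [hp.coprime_iff_not_dvd]
    intro hd
    have h1 : p ∣ 4 * m + 1 := hpt ▸ dvd_pow_self p (by omega)
    have h2 : p ∣ 1 := (Nat.dvd_add_right (hd.mul_left 4)).mp h1
    exact hp.one_lt.ne' (Nat.dvd_one.mp h2)
  refine ⟨Ψ.ker, fun x => ⟨fun hx => ⟨2 * t, ?_⟩, ?_⟩, ?_⟩
  · rw [mul_comm, pow_mul, ← natCast_zsmul, Nat.cast_pow, hq]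
    exact hker x hx
  · rintro ⟨n, hn⟩
    have h1 : ((p ^ n : ℕ) : ℤ) • Ψ x = 0 := by
      rw [natCast_zsmul, ← map_nsmul, hn, map_zero]
    obtain ⟨u, v, huv⟩ := Nat.isCoprime_iff_coprime.mpr (hcop.pow_left n)
    rw [AddMonoidHom.mem_ker, ← one_smul ℤ (Ψ x), ← huv, add_smul, mul_smul, mul_smul, h1, hmP,
      smul_zero, smul_zero, add_zero]
  · obtain ⟨e⟩ := nonempty_addEquiv_ker_prod Ψ hsurj ((4 * (m : ℤ) + 1) ^ 2) (fun w => by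
      have : (4 * (m : ℤ) + 1) ^ 2 = (16 * m + 8) * m + 1 := by ring
      rw [this, add_smul, mul_smul, hmP, smul_zero, zero_add, one_smul]) hker
    exact ⟨e.trans ((AddEquiv.refl _).prodCongr B.equivFun.toAddEquiv)⟩


/-- The `p`-complementary part of the critical group of the Paley graph `P(q)`,
`q = p^t`, is isomorphic to `(ℤ/μℤ)^{2μ}`, where `μ = (q-1)/4`.  Here the
critical group `K` is the torsion subgroup of the cokernel of the Laplacian,
and we assert that `K` is the direct sum of its `p`-primary component `Kp`
and a group isomorphic to `(ℤ/μℤ)^{2μ}`. -/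
theorem paley_critical_group_p_complement
    (p t q : ℕ) (hp : p.Prime) (ht : 1 ≤ t) (hq : q = p ^ t) (hq4 : q % 4 = 1)
    (F : Type*) [Field F] [Fintype F] [DecidableEq F]
    [DecidablePred (IsSquare : F → Prop)]
    (hcard : Fintype.card F = q)
    (L : Matrix F F ℤ)
    (hL : ∀ x y : F, L x y =
      (if x = y then (((q - 1) / 2 : ℕ) : ℤ) else 0) -
        (if x ≠ y ∧ IsSquare (x - y) then 1 else 0)) :
    ∃ Kp : AddSubgroup
        (Submodule.torsion ℤ ((F → ℤ) ⧸ LinearMap.range (Matrix.toLin' L))),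
      (∀ x, x ∈ Kp ↔ ∃ n : ℕ, (p ^ n : ℕ) • x = 0) ∧
      Nonempty
        ((Submodule.torsion ℤ ((F → ℤ) ⧸ LinearMap.range (Matrix.toLin' L))) ≃+
          (Kp × (Fin (2 * ((q - 1) / 4)) → ZMod ((q - 1) / 4)))) := by
  obtain ⟨m, rfl⟩ : ∃ m, q = 4 * m + 1 := ⟨q / 4, by omega⟩
  have hm0 : m ≠ 0 := by
    rintro rfl
    exact absurd hq (Nat.one_lt_pow (by omega) hp.one_lt).ne
  have hm4 : (4 * m + 1 - 1) / 4 = m := by omega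
  have hm2 : (4 * m + 1 - 1) / 2 = 2 * m := by omega
  obtain ⟨hrow, hcol, hsq, σ, hσ⟩ := paley_laplacian_properties m hcard L (fun x y => by
    rw [hL, hm2]; push_cast; rfl)
  rw [hm4]
  exact nonempty_addEquiv_torsion_coker p t m hp hq ht hm0 hcard L hrow hcol hsq σ hσ
end

section
/- The Laplacian matrix of the Paley graph P(q) is equivalent over R = Z_p[ξ_{q−1}] to the diagonal matrix with diagonal entries J(T^{−i}, T^k) for i=1,…,q−2, i≠k, together with two entries equal to 1 and one entry equal to 0. -/
open WittVector

/-- The Teichmüller character raised to an integer power `a`, extended to all of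
`F` by the convention that nonprincipal characters take the value `0` at `0`.
Here `R = W(F) = ℤ_p[ξ_{q−1}]` is the ring of Witt vectors of `F = F_q`. -/
noncomputable def teichPowW (p : ℕ) [hp : Fact p.Prime]
    {F : Type*} [Field F] [DecidableEq F] (a : ℤ) (x : F) : WittVector p F :=
  if h : x = 0 then 0
  else (((IsUnit.map (WittVector.teichmuller p) (Ne.isUnit h)).unit ^ a :
    (WittVector p F)ˣ) : WittVector p F)

/-- The Jacobi sum `J(T^a, T^b) = ∑_{x ∈ F} T^a(x) T^b(1−x)` of powers of the
Teichmüller character, with values in `W(F) = ℤ_p[ξ_{q−1}]`. -/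
noncomputable def jacobiSumW (p : ℕ) [Fact p.Prime]
    {F : Type*} [Field F] [Fintype F] [DecidableEq F] (a b : ℤ) : WittVector p F :=
  ∑ x : F, teichPowW p a x * teichPowW p b (1 - x)

/-! ### The matrix of a quadratic character and its square -/

section CharMatrix

variable {F R : Type*} [Field F] [CommRing R]

/-- The matrix `(χ (x - y))` attached to a multiplicative character `χ`. -/
def charMatrix (χ : MulChar F R) : Matrix F F R := Matrix.of fun x y => χ (x - y)

variable [Fintype F]

lemma sum_apply_sub_mul_apply (χ ψ : MulChar F R) {x : F} (hx : x ≠ 0) :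
    ∑ y, χ (x - y) * ψ y = jacobiSum ψ χ * (ψ * χ) x := by
  rw [← Equiv.sum_comp (Equiv.mulLeft₀ x hx), jacobiSum, Finset.sum_mul]
  refine Finset.sum_congr rfl fun y _ => ?_
  rw [Equiv.mulLeft₀_apply, show x - x * y = x * (1 - y) by ring, map_mul, map_mul,
    MulChar.mul_apply]
  ring

lemma sum_mulChar_one [DecidableEq F] :
    ∑ x, (1 : MulChar F R) x = (Fintype.card F : R) - 1 := by
  rw [MulChar.sum_one_eq_card_units, Fintype.card_eq_card_units_add_one (α := F)]
  push_cast
  ring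

variable [IsDomain R]

lemma sum_apply_sub_mul_apply_eq_zero (χ ψ : MulChar F R) (h : ψ * χ ≠ 1) :
    ∑ y, χ (0 - y) * ψ y = 0 := by
  have : ∀ y, χ (0 - y) * ψ y = χ (-1) * (ψ * χ) y := fun y => by
    rw [zero_sub, neg_eq_neg_one_mul, map_mul, MulChar.mul_apply]
    ring
  simp_rw [this, ← Finset.mul_sum, MulChar.sum_eq_zero_of_ne_one h, mul_zero]

lemma sum_apply_sub_mul_apply_of_ne_one (χ ψ : MulChar F R) (h : ψ * χ ≠ 1) (x : F) :
    ∑ y, χ (x - y) * ψ y = jacobiSum ψ χ * (ψ * χ) x := by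
  rcases eq_or_ne x 0 with rfl | hx
  · rw [sum_apply_sub_mul_apply_eq_zero χ ψ h, MulChar.map_zero, mul_zero]
  · exact sum_apply_sub_mul_apply χ ψ hx

lemma charMatrix_mul_ones {χ : MulChar F R} (hχ : χ ≠ 1) :
    charMatrix χ * (Matrix.of fun _ _ => 1 : Matrix F F R) = 0 := by
  ext x z
  have := MulChar.sum_eq_zero_of_ne_one hχ
  rw [← Equiv.sum_comp (Equiv.subLeft x)] at this
  simpa [charMatrix, Matrix.mul_apply] using this

variable [DecidableEq F] {χ : MulChar F R}

lemma sum_apply_sub_mul_self (hχ : χ ≠ 1) (hsq : χ * χ = 1) (hneg : χ (-1) = 1) (x : F) :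
    ∑ y, χ (x - y) * χ y = (if x = 0 then (Fintype.card F : R) else 0) - 1 := by
  split_ifs with hx
  · subst hx
    have : ∀ y, χ (0 - y) * χ y = (1 : MulChar F R) y := fun y => by
      rw [← hsq, MulChar.mul_apply, zero_sub, neg_eq_neg_one_mul, map_mul, hneg, one_mul]
    simp_rw [this, sum_mulChar_one]
  · rw [sum_apply_sub_mul_apply χ χ hx, hsq, MulChar.one_apply (Ne.isUnit hx)]
    nth_rw 2 [← inv_eq_of_mul_eq_one_left hsq]
    rw [jacobiSum_nontrivial_inv hχ, hneg]
    ring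

lemma charMatrix_mul_self (hχ : χ ≠ 1) (hsq : χ * χ = 1) (hneg : χ (-1) = 1) :
    charMatrix χ * charMatrix χ =
      (Fintype.card F : R) • (1 : Matrix F F R) - Matrix.of fun _ _ => 1 := by
  ext x z
  have := sum_apply_sub_mul_self hχ hsq hneg (x - z)
  rw [← Equiv.sum_comp (Equiv.subRight z)] at this
  simpa [charMatrix, Matrix.mul_apply, Matrix.one_apply, sub_eq_zero] using this

/-- If `2 L = q - J - C`, with `C` the matrix of a quadratic character, then `L` and `C` differ
by an invertible factor, because `C ^ 2 = q - J`. -/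
lemma exists_mul_eq_charMatrix (hχ : χ ≠ 1) (hsq : χ * χ = 1) (hneg : χ (-1) = 1)
    {u v : R} (hu : u * ((Fintype.card F : R) - 1) = 1) (hv : v * 2 = 1)
    {L : Matrix F F R}
    (hL : (2 : R) • L = (Fintype.card F : R) • (1 : Matrix F F R) - (Matrix.of fun _ _ => 1)
      - charMatrix χ) :
    ∃ V W : Matrix F F R, V * W = 1 ∧ L * V = charMatrix χ := by
  have hC := charMatrix_mul_self hχ hsq hneg
  have hJ := charMatrix_mul_ones hχ
  set C := charMatrix χ
  set J : Matrix F F R := Matrix.of fun _ _ => 1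
  set q : R := (Fintype.card F : R)
  have hJC : J * C = 0 := by
    have hJ' : J * C = q • C - C * C * C := by rw [hC, sub_mul, smul_mul_assoc, one_mul]; abel
    rw [hJ', mul_assoc, hC, mul_sub, hJ, mul_smul_comm, mul_one]
    simp
  have hinv : (C + 1 - J) * (C - 1) = (q - 1) • (1 : Matrix F F R) := by
    simp only [sub_mul, add_mul, mul_sub, mul_one, one_mul, hC, hJC, sub_smul, one_smul]
    abel
  have hCJ : C * (C - 1) * (C + 1 - J) = (q - 1) • C := by
    rw [mul_assoc]
    simp only [sub_mul, mul_add, mul_sub, mul_one, one_mul, hC, hJ, sub_smul, one_smul,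
      mul_smul_comm, mul_zero]
    abel
  have hL' : (2 : R) • L = C * (C - 1) := by rw [hL, mul_sub, hC, mul_one]
  refine ⟨(2 * u) • (C + 1 - J), v • (C - 1), ?_, ?_⟩
  · rw [smul_mul_smul_comm, hinv, smul_smul,
      show 2 * u * v * (q - 1) = (v * 2) * (u * (q - 1)) by ring, hu, hv, one_mul, one_smul]
  · rw [mul_smul_comm, mul_comm 2 u, mul_smul, ← smul_mul_assoc, hL', hCJ, smul_smul, hu, one_smul]

end CharMatrix

/-! ### Bases of characters -/

section CharBasis

variable {F R : Type*} [Field F] [DecidableEq F] [CommRing R]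

/-- The basis of `F → R` formed by `1`, the indicator function of `0`, and the characters
`θ ^ (-j)` for `0 < j < q - 1`. -/
noncomputable def charBasis (θ : MulChar F R) (q : ℕ) : Matrix F (Fin q) R :=
    Matrix.of fun x j =>
  if (j : ℕ) = 0 then 1 else if (j : ℕ) = q - 1 then (if x = 0 then 1 else 0)
  else (θ ^ (-(j : ℤ))) x

/-- The basis dual to `charBasis θ q`, where `u` is the inverse of `q - 1`. -/
noncomputable def charBasisDual (θ : MulChar F R) (q : ℕ) (u : R) : Matrix (Fin q) F R :=
    Matrix.of fun j x =>
  if (j : ℕ) = 0 then u * (θ ^ (0 : ℤ)) x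
  else if (j : ℕ) = q - 1 then (if x = 0 then 1 else 0) - u * (θ ^ (0 : ℤ)) x
  else u * (θ ^ (j : ℤ)) x

/-- The basis of `F → R` formed by the indicator function of `0`, by `q` times this indicator
function minus `1` (in position `k`), and the characters `θ ^ (k - j)` for `j ≠ 0, k`. -/
noncomputable def shiftedCharBasis (θ : MulChar F R) (q k : ℕ) : Matrix F (Fin q) R :=
    Matrix.of fun x j =>
  if (j : ℕ) = 0 then (if x = 0 then 1 else 0)
  else if (j : ℕ) = k then (q : R) * (if x = 0 then 1 else 0) - 1
  else (θ ^ ((k : ℤ) - j)) x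

/-- The basis dual to `shiftedCharBasis θ q k`, where `u` is the inverse of `q - 1`. -/
noncomputable def shiftedCharBasisDual (θ : MulChar F R) (q k : ℕ) (u : R) : Matrix (Fin q) F R :=
  Matrix.of fun j x =>
    if (j : ℕ) = 0 then 1
    else if (j : ℕ) = k then -(u * (θ ^ (0 : ℤ)) x)
    else u * (θ ^ ((j : ℤ) - k)) x

variable [Fintype F] {θ : MulChar F R} {q k : ℕ} {u : R}

omit [DecidableEq F] [Fintype F] in
lemma zpow_apply_mul_zpow_apply (θ : MulChar F R) (a b : ℤ) (x : F) :
    (θ ^ a) x * (θ ^ b) x = (θ ^ (a + b)) x := by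
  rw [zpow_add, MulChar.mul_apply]

lemma sum_zpow_zero (θ : MulChar F R) (hq : Fintype.card F = q) :
    ∑ x, (θ ^ (0 : ℤ)) x = (q : R) - 1 := by
  rw [zpow_zero, sum_mulChar_one, hq]

variable [IsDomain R]

omit [DecidableEq F] in
lemma sum_zpow_eq_zero {a : ℤ} (ha : ¬ (orderOf θ : ℤ) ∣ a) : ∑ x, (θ ^ a) x = 0 :=
  MulChar.sum_eq_zero_of_ne_one fun h => ha (orderOf_dvd_iff_zpow_eq_one.mpr h)

omit [DecidableEq F] [Fintype F] [IsDomain R] in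
lemma not_orderOf_dvd (hθ : orderOf θ = q - 1) {a : ℤ} (h0 : a ≠ 0) (h1 : a < q - 1)
    (h2 : -(q - 1) < a) : ¬ (orderOf θ : ℤ) ∣ a := by
  intro h
  refine h0 (Int.eq_zero_of_abs_lt_dvd h ?_)
  rw [abs_lt]
  omega

lemma charBasisDual_mul_charBasis (hq : Fintype.card F = q) (hq1 : 1 < q)
    (hθ : orderOf θ = q - 1) (hu : u * ((q : R) - 1) = 1) :
    charBasisDual θ q u * charBasis θ q = 1 := by
  have h0 := sum_zpow_zero θ hq
  ext i j
  have hi := i.isLt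
  have hj := j.isLt
  have hne : ∀ a : ℤ, a ≠ 0 → a < q - 1 → -(q - 1) < a → ∑ x, (θ ^ a) x = 0 :=
    fun a h1 h2 h3 => sum_zpow_eq_zero (not_orderOf_dvd hθ h1 h2 h3)
  rw [Matrix.mul_apply, Matrix.one_apply]
  simp only [Fin.ext_iff, charBasisDual, charBasis, Matrix.of_apply]
  split_ifs <;> try omega
  all_goals
    simp only [mul_one, mul_ite, mul_zero, sub_mul, Finset.sum_sub_distrib, ite_mul, one_mul,
      zero_mul, mul_assoc, zpow_apply_mul_zpow_apply, ← Finset.mul_sum, Finset.sum_ite_eq',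
      Finset.mem_univ, if_true, MulChar.map_zero, h0, hu, sub_zero, sub_self]
  all_goals first
    | rw [hne _ (by omega) (by omega) (by omega)] <;> simp
    | rw [show (i : ℤ) + -(j : ℤ) = 0 by omega, h0, hu]

lemma shiftedCharBasisDual_mul_shiftedCharBasis (hq : Fintype.card F = q) (hk : 0 < k)
    (hqk : q = 2 * k + 1) (hθ : orderOf θ = q - 1) (hu : u * ((q : R) - 1) = 1) :
    shiftedCharBasisDual θ q k u * shiftedCharBasis θ q k = 1 := by
  have h0 := sum_zpow_zero θ hq
  ext i j
  have hi := i.isLt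
  have hj := j.isLt
  have hne : ∀ a : ℤ, a ≠ 0 → a < q - 1 → -(q - 1) < a → ∑ x, (θ ^ a) x = 0 :=
    fun a h1 h2 h3 => sum_zpow_eq_zero (not_orderOf_dvd hθ h1 h2 h3)
  rw [Matrix.mul_apply, Matrix.one_apply]
  simp only [Fin.ext_iff, shiftedCharBasisDual, shiftedCharBasis, Matrix.of_apply]
  split_ifs <;> try omega
  all_goals
    simp only [mul_one, mul_ite, mul_zero, mul_sub, Finset.sum_sub_distrib, one_mul,
      zero_mul, mul_assoc, neg_mul, Finset.sum_neg_distrib, zpow_apply_mul_zpow_apply,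
      ← Finset.mul_sum, Finset.sum_ite_eq', Finset.mem_univ, if_true, MulChar.map_zero, h0, hu,
      sub_self, neg_zero, Finset.sum_const, Finset.card_univ,
      hq, nsmul_eq_mul]
  all_goals first
    | rw [hne _ (by omega) (by omega) (by omega)] <;> simp
    | rw [show (i : ℤ) - k + (k - j) = 0 by omega, h0, hu]
    | ring

lemma charMatrix_mul_charBasis (hq : Fintype.card F = q) (hk : 0 < k)
    (hqk : q = 2 * k + 1) (hθ : orderOf θ = q - 1) (hneg : (θ ^ (k : ℤ)) (-1) = 1)
    {d : Fin q → R}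
    (hd : ∀ j : Fin q, d j =
      if (j : ℕ) = 0 then 0
      else if (j : ℕ) = k ∨ (j : ℕ) = q - 1 then 1
      else jacobiSum (θ ^ (-(j : ℤ))) (θ ^ (k : ℤ))) :
    charMatrix (θ ^ (k : ℤ)) * charBasis θ q =
      shiftedCharBasis θ q k * Matrix.diagonal d := by
  have hne : ∀ a : ℤ, a ≠ 0 → a < q - 1 → -(q - 1) < a → θ ^ a ≠ 1 :=
    fun a h1 h2 h3 h => not_orderOf_dvd hθ h1 h2 h3 (orderOf_dvd_iff_zpow_eq_one.mpr h)
  have hχ : θ ^ (k : ℤ) ≠ 1 := hne _ (by omega) (by omega) (by omega)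
  have hsq : θ ^ (k : ℤ) * θ ^ (k : ℤ) = 1 := by
    rw [← zpow_add, ← orderOf_dvd_iff_zpow_eq_one, hθ]
    exact ⟨1, by omega⟩
  have hinv : θ ^ (-(k : ℤ)) = θ ^ (k : ℤ) := by
    rw [zpow_neg]
    exact inv_eq_of_mul_eq_one_left hsq
  ext x j
  have hj := j.isLt
  rw [Matrix.mul_diagonal, Matrix.mul_apply, hd]
  by_cases h0 : (j : ℕ) = 0
  · simpa [charMatrix, charBasis, h0, Matrix.mul_apply] using
      congrFun₂ (charMatrix_mul_ones hχ) x x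
  by_cases h1 : (j : ℕ) = q - 1
  · have hB : ∀ y, charBasis θ q y j = if y = 0 then 1 else 0 := fun y =>
      (if_neg h0).trans (if_pos h1)
    have hB' : shiftedCharBasis θ q k x j = (θ ^ (-(k : ℤ))) x := by
      rw [show -(k : ℤ) = k - j by omega]
      exact (if_neg h0).trans (if_neg (by omega))
    rw [if_neg h0, if_pos (Or.inr h1), hB', hinv, mul_one]
    simp_rw [hB]
    simp [charMatrix]
  by_cases h2 : (j : ℕ) = k
  · have hB : ∀ y, charBasis θ q y j = (θ ^ (k : ℤ)) y := fun y => by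
      rw [← hinv, show -(k : ℤ) = -j by omega]
      exact (if_neg h0).trans (if_neg h1)
    have hB' : shiftedCharBasis θ q k x j = (q : R) * (if x = 0 then 1 else 0) - 1 :=
      (if_neg h0).trans (if_pos h2)
    rw [if_neg h0, if_pos (Or.inl h2), hB', mul_one, mul_ite, mul_one, mul_zero]
    simp_rw [hB]
    exact hq ▸ sum_apply_sub_mul_self hχ hsq hneg x
  · have h3 : θ ^ (-(j : ℤ)) * θ ^ (k : ℤ) = θ ^ ((k : ℤ) - j) := by
      rw [← zpow_add]
      ring_nf
    have := sum_apply_sub_mul_apply_of_ne_one (θ ^ (k : ℤ)) (θ ^ (-(j : ℤ)))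
      (h3 ▸ hne _ (by omega) (by omega) (by omega)) x
    rw [h3] at this
    simpa [charMatrix, charBasis, shiftedCharBasis, h0, h1, h2, mul_comm] using this

omit [DecidableEq F] [Fintype F] [IsDomain R] in
lemma isUnit_det_submatrix_of_mul_eq_one {m n : Type*} [Fintype m] [DecidableEq m] [Fintype n]
    [DecidableEq n] {A : Matrix m n R} {B : Matrix n m R} (h : A * B = 1) (e : n ≃ m) :
    IsUnit (A.submatrix id e.symm).det := by
  refine Matrix.isUnit_det_of_right_inverse (B := B.submatrix e.symm id) ?_
  rw [Matrix.submatrix_mul_equiv, h, Matrix.submatrix_id_id]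

/-- A matrix `L` over a domain with `2 L = q - J - C`, where `C` is the matrix of the quadratic
character `θ ^ k`, is equivalent to a diagonal matrix of Jacobi sums. -/
theorem exists_equivalent_diagonal_jacobiSum (hq : Fintype.card F = q) (hk : 0 < k)
    (hqk : q = 2 * k + 1) (hθ : orderOf θ = q - 1) (hneg : (θ ^ (k : ℤ)) (-1) = 1)
    {v : R} (hu : u * ((q : R) - 1) = 1) (hv : v * 2 = 1) {L : Matrix F F R}
    (hL : (2 : R) • L = (q : R) • (1 : Matrix F F R) - (Matrix.of fun _ _ => 1)
      - charMatrix (θ ^ (k : ℤ)))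
    {d : Fin q → R}
    (hd : ∀ j : Fin q, d j =
      if (j : ℕ) = 0 then 0
      else if (j : ℕ) = k ∨ (j : ℕ) = q - 1 then 1
      else jacobiSum (θ ^ (-(j : ℤ))) (θ ^ (k : ℤ))) (e : F ≃ Fin q) :
    ∃ P Q : Matrix (Fin q) (Fin q) R,
      IsUnit P.det ∧ IsUnit Q.det ∧ P * Matrix.reindex e e L * Q = Matrix.diagonal d := by
  have hχ : θ ^ (k : ℤ) ≠ 1 := fun h => not_orderOf_dvd (a := k) hθ (by omega) (by omega)
    (by omega) (orderOf_dvd_iff_zpow_eq_one.mpr h)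
  have hsq : θ ^ (k : ℤ) * θ ^ (k : ℤ) = 1 := by
    rw [← zpow_add, ← orderOf_dvd_iff_zpow_eq_one, hθ]
    exact ⟨1, by omega⟩
  obtain ⟨V, W, hVW, hLV⟩ := exists_mul_eq_charMatrix hχ hsq hneg
    (by rwa [hq]) hv (by rwa [hq])
  have hE := charBasisDual_mul_charBasis hq (by omega) hθ hu
  have hE' := shiftedCharBasisDual_mul_shiftedCharBasis hq hk hqk hθ hu
  have hCB := charMatrix_mul_charBasis hq hk hqk hθ hneg hd
  refine ⟨(shiftedCharBasisDual θ q k u).submatrix id e.symm,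
    (V * charBasis θ q).submatrix e.symm id, isUnit_det_submatrix_of_mul_eq_one hE' e, ?_, ?_⟩
  · refine Matrix.isUnit_det_of_left_inverse
      (B := (charBasisDual θ q u * W).submatrix id e.symm) ?_
    rw [Matrix.submatrix_mul_equiv, Matrix.mul_assoc, ← Matrix.mul_assoc W,
      mul_eq_one_comm.mp hVW, Matrix.one_mul, hE, Matrix.submatrix_id_id]
  · rw [Matrix.reindex_apply, Matrix.submatrix_mul_equiv, Matrix.submatrix_mul_equiv,
      Matrix.submatrix_id_id, Matrix.mul_assoc, ← Matrix.mul_assoc L, hLV, hCB,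
      ← Matrix.mul_assoc, hE', Matrix.one_mul]

end CharBasis

/-! ### The Teichmüller character -/

section Teichmuller

variable (p : ℕ) [Fact p.Prime] (F : Type*) [Field F]

/-- The Teichmüller character as a multiplicative character. -/
noncomputable def teichChar : MulChar F (WittVector p F) :=
  MulChar.ofUnitHom (Units.map (WittVector.teichmuller p))

variable {F}

lemma teichChar_apply (x : F) : teichChar p F x = WittVector.teichmuller p x := by
  rcases eq_or_ne x 0 with rfl | hx
  · rw [MulChar.map_zero, WittVector.teichmuller_zero]
  · lift x to Fˣ using hx.isUnit
    exact MulChar.ofUnitHom_coe _ _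

lemma teichPowW_eq [DecidableEq F] (a : ℤ) (x : F) :
    teichPowW p a x = (teichChar p F ^ a) x := by
  rw [teichPowW]
  split_ifs with h
  · rw [h, MulChar.map_zero]
  · lift x to Fˣ using Ne.isUnit h
    rw [MulChar.zpow_apply_coe, teichChar, MulChar.ofUnitHom_coe, map_zpow]
    congr 2
    ext
    simp

lemma jacobiSumW_eq [Fintype F] [DecidableEq F] (a b : ℤ) :
    jacobiSumW p a b = jacobiSum (teichChar p F ^ a) (teichChar p F ^ b) := by
  simp only [jacobiSumW, jacobiSum, teichPowW_eq]

lemma teichmuller_injective : Function.Injective (WittVector.teichmuller p : F →* WittVector p F) :=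
  fun x y h => by
    simpa only [WittVector.teichmuller_coeff_zero] using congrArg (fun w => w.coeff 0) h

lemma teichChar_pow_apply {n : ℕ} (hn : n ≠ 0) (x : F) :
    (teichChar p F ^ n) x = WittVector.teichmuller p (x ^ n) := by
  rw [MulChar.pow_apply' _ hn, teichChar_apply, map_pow]

lemma orderOf_teichChar [Fintype F] : orderOf (teichChar p F) = Fintype.card F - 1 := by
  classical
  have hcard : 1 < Fintype.card F := Fintype.one_lt_card
  have key : ∀ n : ℕ, n ≠ 0 → (teichChar p F ^ n = 1 ↔ ∀ x : Fˣ, x ^ n = 1) := fun n hn => by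
    rw [MulChar.ext_iff]
    refine forall_congr' fun x => ?_
    rw [teichChar_pow_apply p hn, MulChar.one_apply_coe, ← map_one (WittVector.teichmuller p),
      (teichmuller_injective p).eq_iff, Units.ext_iff, Units.val_pow_eq_pow_val, Units.val_one]
  rw [← Fintype.card_units, orderOf_eq_iff Fintype.card_pos]
  refine ⟨(key _ Fintype.card_ne_zero).mpr fun x => pow_card_eq_one, fun m hm hm0 h => ?_⟩
  obtain ⟨g, hg⟩ := IsCyclic.exists_generator (α := Fˣ)
  have := Nat.le_of_dvd hm0 (orderOf_dvd_of_pow_eq_one ((key m hm0.ne').mp h g))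
  rw [orderOf_eq_card_of_forall_mem_zpowers hg, Nat.card_eq_fintype_card] at this
  omega

variable [CharP F p]

lemma teichmuller_neg_one (hp : ringChar F ≠ 2) :
    WittVector.teichmuller p (-1 : F) = -1 := by
  have h : WittVector.teichmuller p (-1 : F) * WittVector.teichmuller p (-1 : F) = 1 := by
    rw [← map_mul, neg_one_mul, neg_neg, map_one]
  refine (mul_self_eq_one_iff.mp h).resolve_left fun h1 => ?_
  rw [← map_one (WittVector.teichmuller p)] at h1
  exact Ring.neg_one_ne_one_of_char_ne_two hp (teichmuller_injective p h1)

/-- The power `T ^ ((q - 1) / 2)` of the Teichmüller character is the quadratic character. -/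
lemma teichChar_pow_card_div_two_apply [Fintype F] (hp : ringChar F ≠ 2) {x : F} (hx : x ≠ 0)
    [Decidable (IsSquare x)] :
    (teichChar p F ^ (Fintype.card F / 2)) x = if IsSquare x then 1 else -1 := by
  have hcard : 1 < Fintype.card F := Fintype.one_lt_card
  rw [teichChar_pow_apply p (by omega)]
  split_ifs with h
  · rw [(FiniteField.isSquare_iff hp hx).mp h, map_one]
  · rw [(FiniteField.pow_dichotomy hp hx).resolve_left fun h' =>
      h ((FiniteField.isSquare_iff hp hx).mpr h'), teichmuller_neg_one p hp]

lemma exists_mul_natCast_eq_one {n : ℕ} (hn : (n : F) ≠ 0) :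
    ∃ u : WittVector p F, u * n = 1 := by
  refine IsUnit.exists_left_inv (WittVector.isUnit_of_coeff_zero_ne_zero _ ?_)
  change WittVector.constantCoeff (n : WittVector p F) ≠ 0
  rwa [map_natCast]

end Teichmuller

/-- The Laplacian matrix of the Paley graph `P(q)` is equivalent over
`R = ℤ_p[ξ_{q−1}] = W(F_q)` to the diagonal matrix with diagonal entries
`J(T^{−i}, T^k)` for `i = 1, …, q−2`, `i ≠ k`, together with two entries `1`
and one entry `0`. -/
theorem paley_laplacian_equivalent_diagonal
    (p t q : ℕ) [hp : Fact p.Prime] (ht : 1 ≤ t) (hq : q = p ^ t) (hq4 : q % 4 = 1)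
    (F : Type*) [Field F] [Fintype F] [DecidableEq F]
    [DecidablePred (IsSquare : F → Prop)]
    (hcard : Fintype.card F = q)
    (L : Matrix F F (WittVector p F))
    (hL : ∀ x y : F, L x y =
      (if x = y then (((q - 1) / 2 : ℕ) : WittVector p F) else 0) -
        (if x ≠ y ∧ IsSquare (x - y) then 1 else 0))
    (d : Fin q → WittVector p F)
    (hd : ∀ j : Fin q, d j =
      if (j : ℕ) = 0 then 0
      else if (j : ℕ) = (q - 1) / 2 ∨ (j : ℕ) = q - 1 then 1
      else jacobiSumW p (-((j : ℕ) : ℤ)) (((q - 1) / 2 : ℕ) : ℤ)) :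
    ∃ (e : F ≃ Fin q) (P Q : Matrix (Fin q) (Fin q) (WittVector p F)),
      IsUnit P.det ∧ IsUnit Q.det ∧
        P * (Matrix.reindex e e L) * Q = Matrix.diagonal d := by
  subst hcard
  have hF2 : ringChar F ≠ 2 := fun h => by
    have := FiniteField.even_card_iff_char_two.mp h
    omega
  have : CharP F p := by
    obtain ⟨n, hr, hn⟩ := FiniteField.card F (ringChar F)
    have hdvd : p ∣ ringChar F ^ (n : ℕ) := hn ▸ hq ▸ dvd_pow_self p (by omega)
    exact ringChar.of_eq ((Nat.prime_dvd_prime_iff_eq hp.out hr).mp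
      (hp.out.dvd_of_dvd_pow hdvd)).symm
  have hcard : 1 < Fintype.card F := Fintype.one_lt_card
  obtain ⟨k, hk⟩ : ∃ k, Fintype.card F = 2 * k + 1 := ⟨Fintype.card F / 2, by omega⟩
  have hk1 : (Fintype.card F - 1) / 2 = k := by omega
  have hk2 : Fintype.card F / 2 = k := by omega
  have hχ : ∀ x : F, x ≠ 0 → (teichChar p F ^ (k : ℤ)) x = if IsSquare x then 1 else -1 :=
    fun x hx => by
      rw [zpow_natCast, ← hk2]
      exact teichChar_pow_card_div_two_apply p hF2 hx
  obtain ⟨u, hu⟩ := exists_mul_natCast_eq_one p (F := F) (n := Fintype.card F - 1) (by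
    rw [Nat.cast_sub hcard.le, FiniteField.cast_card_eq_zero]
    simp)
  obtain ⟨v, hv⟩ := exists_mul_natCast_eq_one p (F := F) (n := 2)
    (by exact_mod_cast Ring.two_ne_zero hF2)
  rw [Nat.cast_sub hcard.le, Nat.cast_one] at hu
  rw [hk1] at hL hd
  refine ⟨Fintype.equivFin F, exists_equivalent_diagonal_jacobiSum (θ := teichChar p F) rfl
    (by omega) hk (orderOf_teichChar p) ?_ hu hv ?_ (by simpa only [jacobiSumW_eq] using hd) _⟩
  · rw [hχ _ (neg_ne_zero.mpr one_ne_zero),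
      if_pos (FiniteField.isSquare_neg_one_iff.mpr (by omega))]
  · have hqR : (Fintype.card F : WittVector p F) = 2 * k + 1 := by exact_mod_cast congrArg _ hk
    ext1 x y
    rcases eq_or_ne x y with rfl | hxy
    · simp [hL, charMatrix, hqR, MulChar.map_zero]
    · have := hχ _ (sub_ne_zero.mpr hxy)
      simp only [Matrix.smul_apply, Matrix.sub_apply, hL, charMatrix, Matrix.of_apply, this,
        Matrix.one_apply_ne hxy, hxy, ne_eq, not_false_eq_true, true_and, if_false, smul_eq_mul]
      split_ifs <;> ring
end

section
/- For integers a, b with a, b, a+b all ≢ 0 (mod q−1), the p-adic valuation of the Jacobi sum J(T^{−a}, T^{−b}) equals (s(a)+s(b)−s(a+b))/(p−1), where s(x) is the sum of base-p digits of the least nonnegative residue of x modulo q−1; equivalently, it equals the number of carries in the base-p addition of a and b modulo q−1. -/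
open WittVector

section GaussSums

variable {p : ℕ} [Fact p.Prime] {F : Type*} [Field F] [Fintype F] [CharP F p]

/-- Jacobi sums are invariant under the Frobenius action on characters. -/
theorem jacobiSum_pow_char {R : Type*} [CommRing R] (χ φ : MulChar F R) :
    jacobiSum (χ ^ p) (φ ^ p) = jacobiSum χ φ := by
  have hp0 : p ≠ 0 := (Fact.out : p.Prime).ne_zero
  unfold jacobiSum
  refine Fintype.sum_bijective (frobenius F p) (bijective_frobenius F p) _ _ fun x ↦ ?_
  rw [MulChar.pow_apply' _ hp0, MulChar.pow_apply' _ hp0, frobenius_def, ← map_pow, ← map_pow,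
    sub_pow_char, one_pow]

theorem gaussSum_pow_char_pow_orderOf {R : Type*} [CommRing R] [IsDomain R] {χ : MulChar F R}
    (hχ : χ ≠ 1) {ψ : AddChar F R} (hψ : ψ.IsPrimitive) :
    orderOf (χ ^ p) = orderOf χ ∧
      gaussSum (χ ^ p) ψ ^ orderOf χ = gaussSum χ ψ ^ orderOf χ := by
  classical
  have hp0 : p ≠ 0 := (Fact.out : p.Prime).ne_zero
  have hdvd : orderOf χ ∣ Fintype.card F - 1 := by
    exact χ.orderOf_dvd_card_sub_one
  have hcop : (orderOf χ).Coprime p := by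
    refine Nat.Coprime.coprime_dvd_left hdvd ?_
    rw [Nat.coprime_comm, Nat.Prime.coprime_iff_not_dvd Fact.out]
    intro h
    obtain ⟨n, -, hc⟩ := FiniteField.card F p
    have h2 : p ∣ Fintype.card F := hc ▸ dvd_pow_self p n.ne_zero
    have := (Nat.dvd_sub_iff_right Fintype.card_pos h2).mp h
    exact (Fact.out : p.Prime).one_lt.ne' (Nat.dvd_one.mp this)
  have hord : orderOf (χ ^ p) = orderOf χ := hcop.orderOf_pow
  have h2 : 2 ≤ orderOf χ := by
    have := χ.orderOf_pos
    have := mt orderOf_eq_one_iff.mp hχ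
    omega
  refine ⟨hord, ?_⟩
  have h1 : (χ ^ p) (-1) = χ (-1) := by
    rw [MulChar.pow_apply' _ hp0, ← map_pow, neg_one_pow_char]
  have key := gaussSum_pow_eq_prod_jacobiSum (χ := χ ^ p) (hord ▸ h2) hψ
  rw [hord, h1] at key
  rw [key, gaussSum_pow_eq_prod_jacobiSum h2 hψ]
  congr 1
  refine Finset.prod_congr rfl fun i _ ↦ ?_
  rw [← pow_mul, mul_comm, pow_mul, jacobiSum_pow_char]

end GaussSums

section Valuation

variable (p : ℕ) [Fact p.Prime] (F : Type*) [Field F] [Fintype F] [CharP F p]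

/-- Existence and basic properties of the `p`-adic valuations `n χ` of the `(q - 1)`-st powers of
the Gauss sums of nontrivial characters `χ` with values in the Witt vectors. -/
theorem exists_valuation_gaussSum_pow {t : ℕ} (hcard : Fintype.card F = p ^ t) :
    ∃ n : MulChar F (WittVector p F) → ℕ,
      (∀ χ φ : MulChar F (WittVector p F), χ ≠ 1 → φ ≠ 1 → χ * φ ≠ 1 →
        ∃ (m : ℕ) (u : (WittVector p F)ˣ), jacobiSum χ φ = (p : WittVector p F) ^ m * u ∧
          n χ + n φ = n (χ * φ) + (p ^ t - 1) * m) ∧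
      (∀ χ : MulChar F (WittVector p F), χ ≠ 1 → n χ + n χ⁻¹ = (p ^ t - 1) * t) ∧
      ∀ χ : MulChar F (WittVector p F), χ ≠ 1 → n (χ ^ p) = n χ := by
  classical
  have hp : Prime (p : WittVector p F) := (WittVector.irreducible p).prime
  have hq : 1 < p ^ t := hcard ▸ Fintype.one_lt_card
  have hchar : ringChar (FractionRing (WittVector p F)) ≠ ringChar F := by
    intro h
    have h0 := ringChar.Nat.cast_ringChar (R := FractionRing (WittVector p F))
    rw [h, ringChar.eq F p, ← map_natCast (algebraMap (WittVector p F) _),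
      map_eq_zero_iff _ (IsFractionRing.injective _ _)] at h0
    exact hp.ne_zero h0
  let Ψ := AddChar.FiniteField.primitiveChar F (FractionRing (WittVector p F)) hchar
  let C := CyclotomicField Ψ.n (FractionRing (WittVector p F))
  let f : WittVector p F →+* C :=
    (algebraMap (FractionRing (WittVector p F)) C).comp
      (algebraMap (WittVector p F) (FractionRing (WittVector p F)))
  have hf : Function.Injective f :=
    (algebraMap (FractionRing (WittVector p F)) C).injective.comp
      (IsFractionRing.injective (WittVector p F) (FractionRing (WittVector p F)))
  have hψ : Ψ.char.IsPrimitive := Ψ.prim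
  have hne {χ : MulChar F (WittVector p F)} (h : χ ≠ 1) : χ.ringHomComp f ≠ 1 :=
    (MulChar.ringHomComp_ne_one_iff hf).mpr h
  have hq0 : (Fintype.card F : C) ≠ 0 := by
    rw [hcard, Nat.cast_pow, ← map_natCast f]
    exact pow_ne_zero _ ((map_ne_zero_iff f hf).mpr hp.ne_zero)
  have hG0 {χ : MulChar F (WittVector p F)} (h : χ ≠ 1) : gaussSum (χ.ringHomComp f) Ψ.char ≠ 0 :=
    gaussSum_ne_zero_of_nontrivial hq0 (hne h) hψ
  have hdvd (χ : MulChar F C) : orderOf χ ∣ p ^ t - 1 := by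
    rw [← hcard]
    exact χ.orderOf_dvd_card_sub_one
  have hP (χ : MulChar F (WittVector p F)) (h : χ ≠ 1) :
      ∃ P : (WittVector p F), f P = gaussSum (χ.ringHomComp f) Ψ.char ^ (p ^ t - 1) := by
    obtain ⟨k, hk⟩ := hdvd (χ.ringHomComp f)
    have h2 : 2 ≤ orderOf (χ.ringHomComp f) := by
      have := (χ.ringHomComp f).orderOf_pos
      have := mt orderOf_eq_one_iff.mp (hne h)
      omega
    refine ⟨(χ (-1) * Fintype.card F * ∏ i ∈ Finset.Ico 1 (orderOf (χ.ringHomComp f) - 1),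
      jacobiSum χ (χ ^ i)) ^ k, ?_⟩
    rw [hk, pow_mul, gaussSum_pow_eq_prod_jacobiSum h2 hψ]
    simp only [map_pow, map_mul, map_natCast, map_prod, MulChar.ringHomComp_apply,
      ← jacobiSum_ringHomComp, MulChar.ringHomComp_pow]
  choose! P hP using hP
  have hP0 {χ : MulChar F (WittVector p F)} (h : χ ≠ 1) : P χ ≠ 0 := by
    intro h0
    have := hP χ h
    rw [h0, map_zero] at this
    exact pow_ne_zero _ (hG0 h) this.symm
  have hfin {x : (WittVector p F)} (hx : x ≠ 0) : FiniteMultiplicity (p : WittVector p F) x :=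
    FiniteMultiplicity.of_prime_left hp hx
  have hmul {x y : (WittVector p F)} (hx : x ≠ 0) (hy : y ≠ 0) :
      multiplicity (p : WittVector p F) (x * y) =
        multiplicity (p : WittVector p F) x + multiplicity (p : WittVector p F) y :=
    multiplicity_mul hp (hfin (mul_ne_zero hx hy))
  have hunit {x : (WittVector p F)} (hx : IsUnit x) : multiplicity (p : WittVector p F) x = 0 :=
    multiplicity_eq_zero.mpr fun h ↦ hp.not_isUnit (isUnit_of_dvd_unit h hx)
  refine ⟨fun χ ↦ multiplicity (p : WittVector p F) (P χ), fun χ φ hχ hφ hχφ ↦ ?_, fun χ hχ ↦ ?_,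
    fun χ hχ ↦ ?_⟩
  · have key : P (χ * φ) * jacobiSum χ φ ^ (p ^ t - 1) = P χ * P φ := by
      apply hf
      rw [map_mul, map_mul, map_pow, hP _ hχ, hP _ hφ, hP _ hχφ, ← jacobiSum_ringHomComp,
        ← mul_pow, ← mul_pow, MulChar.ringHomComp_mul, jacobiSum_mul_nontrivial]
      rw [← MulChar.ringHomComp_mul]
      exact hne hχφ
    have hJ : jacobiSum χ φ ≠ 0 := by
      intro h0
      rw [h0, zero_pow (by omega), mul_zero] at key
      exact mul_ne_zero (hP0 hχ) (hP0 hφ) key.symm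
    obtain ⟨m, u, hm⟩ := WittVector.exists_eq_pow_p_mul' _ hJ
    refine ⟨m, u, hm, ?_⟩
    have h1 := congrArg (multiplicity (p : WittVector p F)) key
    rw [hmul (hP0 hχ) (hP0 hφ), hmul (hP0 hχφ) (pow_ne_zero _ hJ), hm, mul_pow, ← pow_mul,
      hmul (pow_ne_zero _ hp.ne_zero) (pow_ne_zero _ u.ne_zero),
      multiplicity_pow_self_of_prime hp, hunit (u.isUnit.pow _)] at h1
    simp only [← h1]
    ring
  · have hinv : χ⁻¹ ≠ 1 := inv_ne_one.mpr hχ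
    have key : P χ * P χ⁻¹ = (χ (-1)) ^ (p ^ t - 1) * (p : WittVector p F) ^ (t * (p ^ t - 1)) := by
      apply hf
      have h1 := gaussSum_mul_gaussSum_eq_card (hne hχ) hψ
      have h2 := mul_gaussSum_inv_eq_gaussSum (χ⁻¹.ringHomComp f) Ψ.char
      rw [map_mul, hP _ hχ, hP _ hinv, ← mul_pow, ← h2, mul_left_comm,
        ← MulChar.ringHomComp_inv, h1, mul_pow, hcard, MulChar.ringHomComp_inv]
      simp only [map_mul, map_pow, map_natCast, Nat.cast_pow, MulChar.ringHomComp_apply,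
        MulChar.inv_apply', inv_neg, inv_one, pow_mul]
    have hu : IsUnit (χ (-1) ^ (p ^ t - 1)) := (isUnit_one.neg.map χ).pow _
    have h1 := congrArg (multiplicity (p : WittVector p F)) key
    rw [hmul (hP0 hχ) (hP0 hinv), hmul hu.ne_zero (pow_ne_zero _ hp.ne_zero),
      multiplicity_pow_self_of_prime hp, hunit hu] at h1
    simp only [h1]
    ring
  · have hpne : χ ^ p ≠ 1 := by
      intro h
      have := (gaussSum_pow_char_pow_orderOf (p := p) (hne hχ) hψ).1
      rw [MulChar.ringHomComp_pow, h, MulChar.ringHomComp_one, orderOf_one] at this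
      exact hne hχ (orderOf_eq_one_iff.mp this.symm)
    have : P (χ ^ p) = P χ := by
      apply hf
      obtain ⟨k, hk⟩ := hdvd (χ.ringHomComp f)
      rw [hP _ hχ, hP _ hpne, hk, pow_mul, pow_mul, ← MulChar.ringHomComp_pow,
        (gaussSum_pow_char_pow_orderOf (p := p) (hne hχ) hψ).2]
    simp only [this]

end Valuation

section Digits

theorem sum_digits_mul_base {p : ℕ} (hp : 1 < p) (m : ℕ) :
    (Nat.digits p (p * m)).sum = (Nat.digits p m).sum := by
  rcases m.eq_zero_or_pos with rfl | hm
  · simp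
  · simp [Nat.digits_base_mul hp hm]

theorem sum_digits_succ {p a : ℕ} (hp : 1 < p) (h : ¬ p ∣ a + 1) :
    (Nat.digits p (a + 1)).sum = (Nat.digits p a).sum + 1 := by
  rcases a.eq_zero_or_pos with rfl | ha
  · simp [Nat.digits_of_lt p 1 one_ne_zero hp]
  · have h1 : 1 % p = 1 := Nat.mod_eq_of_lt hp
    have h2 : a % p + 1 % p < p := by
      have h3 := Nat.mod_lt a (zero_lt_one.trans hp)
      rw [h1]
      refine lt_of_le_of_ne h3 fun h4 ↦ h ?_
      rw [Nat.dvd_iff_mod_eq_zero, Nat.add_mod, h1, h4, Nat.mod_self]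
    rw [Nat.digits_def' hp a.succ_pos, Nat.digits_def' hp ha, Nat.succ_div_of_not_dvd h,
      Nat.add_mod_of_add_mod_lt h2, h1]
    simp only [List.sum_cons]
    ring

theorem sum_digits_pow_sub_one {p : ℕ} (hp : 1 < p) (t : ℕ) :
    (Nat.digits p (p ^ t - 1)).sum = t * (p - 1) := by
  induction t with
  | zero => simp
  | succ t ih =>
    have h1 : p ^ (t + 1) - 1 = (p - 1) + p * (p ^ t - 1) := by
      have := Nat.pow_pos (n := t) (zero_lt_one.trans hp)
      rw [Nat.mul_sub, pow_succ']
      have : p * 1 ≤ p * p ^ t := Nat.mul_le_mul_left p this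
      omega
    rcases (p ^ t - 1).eq_zero_or_pos with h0 | h0
    · rw [h0] at h1 ih
      rw [h1, mul_zero, add_zero, Nat.digits_of_lt p (p - 1) (by omega) (by omega)]
      simp only [Nat.digits_zero, List.sum_nil] at ih
      rw [add_mul, ← ih]
      simp
    · rw [h1, Nat.digits_add p hp (p - 1) _ (by omega) (Or.inr h0.ne')]
      rw [List.sum_cons, ih]
      ring

end Digits

section Teichmuller

variable (p : ℕ) [Fact p.Prime] (F : Type*) [Field F]

/-- The Teichmüller character of a field as a multiplicative character. -/
noncomputable def teichmullerChar : MulChar F (WittVector p F) where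
  __ := WittVector.teichmuller p
  map_nonunit' x hx := by
    obtain rfl : x = 0 := by simpa using hx
    exact WittVector.teichmuller_zero p

variable {F} in
theorem teichmullerChar_apply (x : F) : teichmullerChar p F x = WittVector.teichmuller p x := rfl

theorem teichPowW_eq_zpow [DecidableEq F] (a : ℤ) (x : F) :
    teichPowW p a x = (teichmullerChar p F ^ a) x := by
  unfold teichPowW
  split_ifs with h
  · rw [h, MulChar.map_zero]
  · have h1 : (IsUnit.map (WittVector.teichmuller p) (Ne.isUnit h)).unit =
        MulChar.mulEquivToUnitHom (teichmullerChar p F) (Units.mk0 x h) :=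
      Units.ext (MulChar.coe_equivToUnitHom (teichmullerChar p F) (Units.mk0 x h)).symm
    have h2 := MulChar.coe_equivToUnitHom (teichmullerChar p F ^ a) (Units.mk0 x h)
    rw [Units.val_mk0] at h2
    rw [h1, ← h2, ← MonoidHom.zpow_apply, ← map_zpow]
    rfl

variable [Fintype F]

theorem jacobiSumW_eq_jacobiSum [DecidableEq F] (a b : ℤ) :
    jacobiSumW p a b = jacobiSum (teichmullerChar p F ^ a) (teichmullerChar p F ^ b) := by
  simp only [jacobiSumW, jacobiSum, teichPowW_eq_zpow]

theorem orderOf_teichmullerChar : orderOf (teichmullerChar p F) = Fintype.card F - 1 := by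
  refine Nat.dvd_antisymm (MulChar.orderOf_dvd_card_sub_one F _)
    ((FiniteField.forall_pow_eq_one_iff F _).mp fun x ↦ ?_)
  have h := congrArg (fun χ : MulChar F (WittVector p F) ↦ (χ (x : F)).coeff 0)
    (pow_orderOf_eq_one (teichmullerChar p F))
  simp only [MulChar.pow_apply_coe, teichmullerChar_apply, ← map_pow, MulChar.one_apply_coe,
    WittVector.teichmuller_coeff_zero, WittVector.one_coeff_zero] at h
  exact Units.ext (by simpa using h)

theorem sum_pow_of_pos {i : ℕ} (hi : 0 < i) :
    ∑ x : F, x ^ i = if Fintype.card F - 1 ∣ i then -1 else 0 := by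
  classical
  rw [← FiniteField.sum_pow_units F i, ← Finset.sum_sdiff ({0} : Finset F).subset_univ,
    Finset.sum_singleton, zero_pow hi.ne', add_zero]
  symm
  refine Finset.sum_bij (fun u _ ↦ (u : F)) (by simp) (fun _ _ _ _ h ↦ Units.ext h)
    (fun x hx ↦ ?_) (by simp)
  exact ⟨Units.mk0 x (by simpa using hx), by simp⟩

theorem sum_one_sub_pow_mul_pow {m : ℕ} (hm : m + 2 ≤ Fintype.card F) :
    ∑ x : F, (1 - x) ^ m * x ^ (Fintype.card F - 2) = m := by
  have h2 : 2 ≤ Fintype.card F := by omega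
  rcases m.eq_zero_or_pos with rfl | hm0
  · simpa using FiniteField.sum_pow_lt_card_sub_one F (Fintype.card F - 2) (by omega)
  have key (x : F) : (1 - x) ^ m * x ^ (Fintype.card F - 2) =
      ∑ k ∈ Finset.range (m + 1), (-1) ^ k * (m.choose k : F) * x ^ (Fintype.card F - 2 + k) := by
    rw [sub_eq_neg_add, add_pow, Finset.sum_mul]
    refine Finset.sum_congr rfl fun k _ ↦ ?_
    rw [neg_pow, one_pow, pow_add]
    ring
  simp_rw [key]
  rw [Finset.sum_comm]
  simp_rw [← Finset.mul_sum]
  rw [Finset.sum_eq_single 1]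
  · rw [sum_pow_of_pos F (by omega),
      if_pos (by rw [show Fintype.card F - 2 + 1 = Fintype.card F - 1 by omega])]
    simp
  · intro k hk hk1
    rw [Finset.mem_range] at hk
    rw [sum_pow_of_pos F (by omega), if_neg, mul_zero]
    rintro ⟨c, hc⟩
    rcases c with _ | _ | c
    · omega
    · omega
    · have : Fintype.card F - 2 + k = (Fintype.card F - 1) * c + 2 * (Fintype.card F - 1) := by
        rw [hc]; ring
      omega
  · intro h
    simp at h
    omega

theorem coeff_zero_jacobiSum_inv_pow {a : ℕ} (ha : 0 < a) (ha' : a + 2 ≤ Fintype.card F) :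
    (jacobiSum ((teichmullerChar p F)⁻¹ ^ a) (teichmullerChar p F)⁻¹).coeff 0 = -(a + 1 : F) := by
  have h1 : (teichmullerChar p F)⁻¹ ^ a = teichmullerChar p F ^ (Fintype.card F - 1 - a) := by
    rw [inv_pow, inv_eq_iff_mul_eq_one, ← pow_add, ← orderOf_teichmullerChar p,
      Nat.add_sub_cancel' (by rw [orderOf_teichmullerChar]; omega), pow_orderOf_eq_one]
  have h2 : (teichmullerChar p F)⁻¹ = teichmullerChar p F ^ (Fintype.card F - 2) := by
    rw [inv_eq_iff_mul_eq_one, ← pow_succ',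
      show Fintype.card F - 2 + 1 = Fintype.card F - 1 by omega,
      ← orderOf_teichmullerChar p, pow_orderOf_eq_one]
  have h3 := sum_one_sub_pow_mul_pow F (m := Fintype.card F - 1 - a) (by omega)
  rw [h1, h2, jacobiSum_comm, jacobiSum, ← WittVector.constantCoeff_apply, map_sum]
  have h4 (x : F) : WittVector.constantCoeff ((teichmullerChar p F ^ (Fintype.card F - 2)) x *
      (teichmullerChar p F ^ (Fintype.card F - 1 - a)) (1 - x)) =
      (1 - x) ^ (Fintype.card F - 1 - a) * x ^ (Fintype.card F - 2) := by
    rw [MulChar.pow_apply' _ (by omega), MulChar.pow_apply' _ (by omega), map_mul,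
      teichmullerChar_apply, teichmullerChar_apply, ← map_pow, ← map_pow, mul_comm]
    rfl
  simp_rw [h4, h3]
  rw [Nat.sub_sub, Nat.cast_sub (by omega), FiniteField.cast_card_eq_zero]
  push_cast
  ring

end Teichmuller

section Stickelberger

variable (p : ℕ) [Fact p.Prime] (F : Type*) [Field F] [Fintype F]

theorem teichmullerChar_inv_pow_ne_one {a : ℕ} (ha : 0 < a) (ha' : a < Fintype.card F - 1) :
    (teichmullerChar p F)⁻¹ ^ a ≠ 1 := by
  rw [inv_pow, Ne, inv_eq_one]
  exact pow_ne_one_of_lt_orderOf ha.ne' (by rwa [orderOf_teichmullerChar])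

/-- Stickelberger's theorem on the valuation of Jacobi sums, for reduced exponents `a`, `b` and
the reduced exponent `c` of the product. -/
theorem exists_jacobiSum_inv_pow_eq [CharP F p] {t a b c : ℕ} (hcard : Fintype.card F = p ^ t)
    (ha : 0 < a) (ha' : a < p ^ t - 1) (hb : 0 < b) (hb' : b < p ^ t - 1)
    (hc : 0 < c) (hc' : c < p ^ t - 1)
    (h : (teichmullerChar p F)⁻¹ ^ a * (teichmullerChar p F)⁻¹ ^ b =
      (teichmullerChar p F)⁻¹ ^ c) :
    ∃ u : (WittVector p F)ˣ,
      jacobiSum ((teichmullerChar p F)⁻¹ ^ a) ((teichmullerChar p F)⁻¹ ^ b) =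
        (p : WittVector p F) ^ (((Nat.digits p a).sum + (Nat.digits p b).sum -
          (Nat.digits p c).sum) / (p - 1)) * u := by
  obtain ⟨n, hmul, hinv, hpow⟩ := exists_valuation_gaussSum_pow p F hcard
  have hp1 : 1 < p := (Fact.out : p.Prime).one_lt
  set χ := (teichmullerChar p F)⁻¹ with hχ
  have hne {k : ℕ} (hk : 0 < k) (hk' : k < p ^ t - 1) : χ ^ k ≠ 1 :=
    teichmullerChar_inv_pow_ne_one p F hk (by rwa [hcard])
  have hdig (k : ℕ) : 0 < k → k < p ^ t - 1 → n (χ ^ k) = (Nat.digits p k).sum * n χ := by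
    induction k using Nat.strong_induction_on with
    | _ k ih =>
      intro hk hk'
      by_cases hpk : p ∣ k
      · obtain ⟨m, rfl⟩ := hpk
        have hm : 0 < m := Nat.pos_of_mul_pos_left hk
        have hlt : m < p * m := lt_mul_of_one_lt_left hm hp1
        rw [sum_digits_mul_base hp1, mul_comm p m, pow_mul, hpow _ (hne hm (hlt.trans hk')),
          ih m hlt hm (hlt.trans hk')]
      · obtain ⟨j, rfl⟩ := Nat.exists_eq_add_of_le' hk
        rcases j.eq_zero_or_pos with rfl | hj
        · simp [Nat.digits_of_lt p 1 one_ne_zero hp1]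
        · obtain ⟨m, u, hJ, hm⟩ := hmul (χ ^ j) χ (hne hj (by omega))
            (by simpa using hne one_pos (by omega)) (by rw [← pow_succ]; exact hne hk hk')
          have h0 := coeff_zero_jacobiSum_inv_pow p F hj (by omega)
          rw [← hχ, hJ] at h0
          obtain rfl : m = 0 := by
            by_contra hm0
            rw [← WittVector.constantCoeff_apply, map_mul, map_pow, map_natCast,
              CharP.cast_eq_zero, zero_pow hm0, zero_mul, eq_comm, neg_eq_zero] at h0
            exact hpk ((CharP.cast_eq_zero_iff F p _).mp (by exact_mod_cast h0))
          rw [← pow_succ, mul_zero, add_zero, ih j (by omega) hj (by omega)] at hm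
          rw [← hm, sum_digits_succ hp1 hpk]
          ring
  have hq : 2 < p ^ t := by omega
  have ht : 0 < t := Nat.pos_of_ne_zero (by rintro rfl; simp at hq)
  have hn : n χ * (p - 1) = p ^ t - 1 := by
    have h1 : χ⁻¹ = χ ^ (p ^ t - 2) := by
      rw [inv_eq_iff_mul_eq_one, ← pow_succ', show p ^ t - 2 + 1 = p ^ t - 1 by omega, hχ,
        inv_pow, ← hcard, ← orderOf_teichmullerChar p, pow_orderOf_eq_one, inv_one]
    have h2 := hinv χ (by simpa using hne one_pos (by omega))
    rw [h1, hdig _ (by omega) (by omega)] at h2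
    have h3 := sum_digits_pow_sub_one hp1 t
    rw [show p ^ t - 1 = p ^ t - 2 + 1 by omega, sum_digits_succ hp1] at h3
    · refine Nat.eq_of_mul_eq_mul_right ht ?_
      rw [← h2, mul_assoc, mul_comm (p - 1), ← h3]
      ring
    · rw [show p ^ t - 2 + 1 = p ^ t - 1 by omega]
      intro hd
      exact hp1.ne' (Nat.dvd_one.mp
        ((Nat.dvd_sub_iff_right (by omega) (dvd_pow_self p ht.ne')).mp hd))
  obtain ⟨m, u, hJ, hm⟩ := hmul _ _ (hne ha ha') (hne hb hb') (h ▸ hne hc hc')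
  refine ⟨u, ?_⟩
  rw [h, hdig a ha ha', hdig b hb hb', hdig c hc hc', ← hn] at hm
  have hn0 : 0 < n χ := Nat.pos_of_ne_zero fun h0 ↦ by
    rw [h0, zero_mul] at hn
    omega
  have hm' : (Nat.digits p a).sum + (Nat.digits p b).sum =
      (Nat.digits p c).sum + (p - 1) * m := by
    refine Nat.eq_of_mul_eq_mul_right hn0 ?_
    linarith
  rw [hJ, hm', Nat.add_sub_cancel_left, Nat.mul_div_cancel_left _ (by omega)]

end Stickelberger

/-- Stickelberger: for integers `a`, `b` with `a`, `b`, `a+b` all `≢ 0 (mod q−1)`,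
the `p`-adic valuation of `J(T^{−a}, T^{−b})` equals `(s(a)+s(b)−s(a+b))/(p−1)`,
where `s(x)` is the base-`p` digit sum of the least nonnegative residue of `x`
modulo `q−1`; i.e. `J(T^{−a}, T^{−b})` is `p^c` times a unit of `ℤ_p[ξ_{q−1}] = W(F_q)`,
where `c` is that quantity (the number of carries in the base-`p` addition of
`a` and `b` modulo `q−1`). -/
theorem jacobi_sum_valuation
    (p t q : ℕ) [hp : Fact p.Prime] (ht : 1 ≤ t) (hq : q = p ^ t)
    (F : Type*) [Field F] [Fintype F] [DecidableEq F]
    (hcard : Fintype.card F = q)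
    (s : ℤ → ℕ) (hs : ∀ x : ℤ, s x = (Nat.digits p ((x % ((q : ℤ) - 1)).toNat)).sum)
    (a b : ℤ)
    (ha : ¬ ((q : ℤ) - 1 ∣ a)) (hb : ¬ ((q : ℤ) - 1 ∣ b)) (hab : ¬ ((q : ℤ) - 1 ∣ a + b)) :
    ∃ u : (WittVector p F)ˣ,
      jacobiSumW p (-a) (-b) =
        (p : WittVector p F) ^ ((s a + s b - s (a + b)) / (p - 1)) * (u : WittVector p F) := by
  have hcp : CharP F p := by
    obtain ⟨r, hr⟩ := CharP.exists F
    have hr' : r.Prime := CharP.char_is_prime F r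
    obtain ⟨k, -, hk⟩ := FiniteField.card F r
    have hdvd : r ∣ p ^ t := by
      rw [← hq, ← hcard, hk]
      exact dvd_pow_self r k.ne_zero
    rwa [← (Nat.prime_dvd_prime_iff_eq hr' hp.out).mp (hr'.dvd_of_dvd_pow hdvd)]
  subst hq
  have hq1 : 1 < p ^ t := hcard ▸ Fintype.one_lt_card
  have hN : ((p ^ t : ℕ) : ℤ) - 1 = ((p ^ t - 1 : ℕ) : ℤ) := by
    rw [Nat.cast_sub hq1.le, Nat.cast_one]
  rw [hN] at ha hb hab
  simp only [hN] at hs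
  have hpos : (0 : ℤ) < ((p ^ t - 1 : ℕ) : ℤ) := by exact_mod_cast Nat.sub_pos_of_lt hq1
  have hred (x : ℤ) (hx : ¬ (((p ^ t - 1 : ℕ) : ℤ) ∣ x)) :
      0 < (x % ((p ^ t - 1 : ℕ) : ℤ)).toNat ∧ (x % ((p ^ t - 1 : ℕ) : ℤ)).toNat < p ^ t - 1 := by
    have h1 := Int.emod_nonneg x hpos.ne'
    have h2 := Int.emod_lt_of_pos x hpos
    have h3 : x % ((p ^ t - 1 : ℕ) : ℤ) ≠ 0 := fun h ↦ hx (Int.dvd_of_emod_eq_zero h)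
    omega
  have hchar (x : ℤ) : teichmullerChar p F ^ (-x) =
      (teichmullerChar p F)⁻¹ ^ (x % ((p ^ t - 1 : ℕ) : ℤ)).toNat := by
    rw [← zpow_natCast, Int.toNat_of_nonneg (Int.emod_nonneg x hpos.ne'), ← hcard,
      ← orderOf_teichmullerChar p, ← orderOf_inv, zpow_mod_orderOf, inv_zpow, zpow_neg]
  rw [jacobiSumW_eq_jacobiSum, hs, hs, hs, hchar, hchar]
  refine exists_jacobiSum_inv_pow_eq p F hcard (hred a ha).1 (hred a ha).2 (hred b hb).1
    (hred b hb).2 (hred _ hab).1 (hred _ hab).2 ?_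
  rw [← hchar, ← hchar, ← hchar, ← zpow_add, neg_add]
end
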